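/- arXiv:1303.1239 — 5 statements merged into one kernel-verified Lean document; each statement's English description precedes it below -/
import Mathlib

section
/- Let x be a free Koszul S-cube over a commutative noetherian ring A associated with an A-sequence {f_s}_{s∈S}. Then: (1) all vertices of x have the same rank; (2) after fixing bases of all vertices (so that every boundary map d_T^{x,k} is represented by a square matrix and has a determinant det d_T^{x,k}), for each T ⊆ S and k ∈ T there is a unit u ∈ A^× with det d_S^{x,k} = u · det d_T^{x,k}. -/
open CategoryTheory CategoryTheory.Limits Opposite

attribute [local instance] CategoryTheory.Abelian.hasFiniteBiproducts

set_option linter.unusedSectionVars false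

universe w v u

/-- An `ι`-cube in a category `𝒜`: a contravariant functor from the poset of finite
subsets of `ι` (ordered by inclusion) to `𝒜`.  An `S`-cube (for `S : Finset ι`) is such a
functor, of which only the values on subsets of `S` are relevant. -/
abbrev Cube (𝒜 : Type u) [Category.{v} 𝒜] (ι : Type w) := (Finset ι)ᵒᵖ ⥤ 𝒜

namespace Cube

variable {𝒜 : Type u} [Category.{v} 𝒜] {ι : Type w} [DecidableEq ι]

/-- The vertex `x_T` of a cube `x` at a finite subset `T`. -/
def vtx (x : Cube 𝒜 ι) (T : Finset ι) : 𝒜 := x.obj (op T)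

/-- The structure morphism `x_T ⟶ x_U` of a cube for `U ⊆ T`. -/
def mapLE (x : Cube 𝒜 ι) {T U : Finset ι} (h : U ⊆ T) : x.vtx T ⟶ x.vtx U :=
  x.map (homOfLE h).op

lemma mapLE_refl (x : Cube 𝒜 ι) (T : Finset ι) (h : T ⊆ T) : x.mapLE h = 𝟙 (x.vtx T) := by
  show x.map (homOfLE h).op = _
  rw [show (homOfLE h).op = 𝟙 (op T) from rfl, x.map_id]; rfl

lemma mapLE_comp (x : Cube 𝒜 ι) {T U V : Finset ι} (h1 : U ⊆ T) (h2 : V ⊆ U) :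
    x.mapLE h1 ≫ x.mapLE h2 = x.mapLE (h2.trans h1) := by
  show x.map _ ≫ x.map _ = x.map _
  rw [← x.map_comp]
  rfl

/-- The `k`-direction boundary morphism `d^k_T : x_T ⟶ x_{T ∖ {k}}` of a cube. -/
def bd (x : Cube 𝒜 ι) (T : Finset ι) (k : ι) : x.vtx T ⟶ x.vtx (T.erase k) :=
  x.mapLE (Finset.erase_subset k T)

end Cube

/-- A list `f₁, …, f_q` of elements of a commutative ring is an *regular sequence* if no
`fᵢ` is a unit and, for each `i`, `f_{i+1}` is a non-zero-divisor on `R/(f₁, …, fᵢ)`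
(the case `i = 0` saying that `f₁` is a non-zero-divisor on `R`). -/
def IsRegularSeq {R : Type*} [CommRing R] (fs : List R) : Prop :=
  (∀ f ∈ fs, ¬ IsUnit f) ∧
  ∀ i : Fin fs.length, ∀ x : R,
    fs.get i * x ∈ Ideal.span {y | y ∈ fs.take i.1} →
    x ∈ Ideal.span {y | y ∈ fs.take i.1}

/-- The family `{f s}_{s ∈ S}` is an *`A`-sequence*: every enumeration of `S` yields an
`A`-regular sequence. -/
def IsFamilyASeq {A : Type u} [CommRing A] {ι : Type w} [DecidableEq ι]
    (S : Finset ι) (f : ι → A) : Prop :=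
  ∀ l : List ι, l.Nodup → l.toFinset = S → IsRegularSeq (l.map f)

/-- `pdLE A n M` : the `A`-module `M` has projective dimension at most `n`. -/
def pdLE (A : Type u) [CommRing A] : ℕ → (M : Type v) → [AddCommGroup M] → [Module A M] → Prop
  | 0, M, _, _ => Module.Projective A M
  | n+1, M, _, _ => ∃ (P : Type v) (_ : AddCommGroup P) (_ : Module A P) (g : P →ₗ[A] M),
      Module.Projective A P ∧ Function.Surjective g ∧ pdLE A n (LinearMap.ker g)

/-- A *Koszul cube* associated with the family `{f s}_{s ∈ S}` : an `S`-cube of finitely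
generated projective `A`-modules such that every boundary morphism `d^k_T` (`k ∈ T ⊆ S`) is
injective and its cokernel is of projective dimension at most `1` and annihilated by some
power of `f k` (i.e. supported on `V(f k · A)`). -/
def IsKoszulCube {A : Type u} [CommRing A] {ι : Type w} [DecidableEq ι]
    (x : Cube (ModuleCat.{u} A) ι) (S : Finset ι) (f : ι → A) : Prop :=
  (∀ T ⊆ S, Module.Finite A (x.vtx T) ∧ Module.Projective A (x.vtx T)) ∧
  (∀ T ⊆ S, ∀ k ∈ T, Function.Injective (x.bd T k) ∧
    pdLE A 1 ((x.vtx (T.erase k)) ⧸ LinearMap.range (x.bd T k).hom) ∧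
    ∃ n : ℕ, ∀ m : (x.vtx (T.erase k)) ⧸ LinearMap.range (x.bd T k).hom, (f k) ^ n • m = 0)

/-- If `f ^ n` kills the cokernel of `d`, then `d ∘ g = f ^ n` for some `g`. -/
lemma koszul_exists_section {A M N κ : Type*} [CommRing A] [AddCommGroup M] [Module A M]
    [AddCommGroup N] [Module A N] (b : Module.Basis κ A N) (d : M →ₗ[A] N) (a : A)
    (h : ∀ m : N ⧸ LinearMap.range d, a • m = 0) :
    ∃ g : N →ₗ[A] M, d ∘ₗ g = a • LinearMap.id := by
  have h1 : ∀ y : N, ∃ z : M, d z = a • y := by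
    intro y
    have := h (Submodule.Quotient.mk y)
    rw [← Submodule.Quotient.mk_smul, Submodule.Quotient.mk_eq_zero] at this
    exact this
  choose s hs using fun i => h1 (b i)
  refine ⟨b.constr A s, b.ext fun i => ?_⟩
  simp [hs]

lemma koszul_det_dvd {A M N κ : Type*} [CommRing A] [AddCommGroup M] [Module A M]
    [AddCommGroup N] [Module A N] [Fintype κ] [DecidableEq κ]
    (b : Module.Basis κ A M) (c : Module.Basis κ A N) (d : M →ₗ[A] N) (f : A)
    (h : ∃ n : ℕ, ∀ m : N ⧸ LinearMap.range d, f ^ n • m = 0) :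
    ∃ n : ℕ, (LinearMap.toMatrix b c d).det ∣ f ^ n := by
  obtain ⟨n, h⟩ := h
  obtain ⟨g, hg⟩ := koszul_exists_section c d _ h
  refine ⟨n * Fintype.card κ, (LinearMap.toMatrix c b g).det, ?_⟩
  rw [← Matrix.det_mul, ← LinearMap.toMatrix_comp, hg]
  simp [LinearMap.toMatrix_id, Matrix.det_smul, pow_mul]

/-- `g` is a non-zero-divisor modulo every divisor of a power of `f`. -/
lemma koszul_nzd_mod {A : Type*} [CommRing A] {f g : A}
    (hf : ∀ y, f * y = 0 → y = 0) (hfg : ∀ y, f ∣ g * y → f ∣ y)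
    {a : A} {n : ℕ} (ha : a ∣ f ^ n) (m : ℕ) (y : A) (h : a ∣ g ^ m * y) : a ∣ y := by
  have hfn : ∀ (n : ℕ) (y), f ^ n * y = 0 → y = 0 := by
    intro n
    induction n with
    | zero => intro y hy; simpa using hy
    | succ n ih => intro y hy; exact ih _ (hf _ (by rw [← hy]; ring))
  have hfgn : ∀ (n : ℕ) (y), f ^ n ∣ g * y → f ^ n ∣ y := by
    intro n
    induction n with
    | zero => intro y _; simp
    | succ n ih =>
      intro y hy
      obtain ⟨z, rfl⟩ := hfg y (Dvd.dvd.trans (dvd_pow_self f (Nat.succ_ne_zero n)) hy)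
      obtain ⟨w, hw⟩ := hy
      have h2 : g * z = f ^ n * w := by
        have : f * (g * z - f ^ n * w) = 0 := by linear_combination hw
        exact sub_eq_zero.mp (hf _ this)
      obtain ⟨v, rfl⟩ := ih z ⟨w, h2⟩
      exact ⟨v, by ring⟩
  obtain ⟨c, hc⟩ := ha
  have hcz : ∀ y, c * y = 0 → y = 0 := fun y hy =>
    hfn n y (by rw [hc, mul_assoc, hy, mul_zero])
  have key : ∀ y, a ∣ g * y → a ∣ y := by
    rintro y ⟨z, hz⟩
    obtain ⟨w, hw⟩ := hfgn n (c * y) ⟨z, by rw [hc]; linear_combination c * hz⟩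
    refine ⟨w, sub_eq_zero.mp (hcz _ ?_)⟩
    rw [hc] at hw
    linear_combination hw
  induction m generalizing y with
  | zero => simpa using h
  | succ m ih => exact key y (ih _ (by rw [pow_succ, mul_assoc] at h; exact h))

lemma koszul_assoc {A : Type*} [CommRing A] {f g : A}
    (hf : ∀ y, f * y = 0 → y = 0) (hfg : ∀ y, f ∣ g * y → f ∣ y)
    {a a' b b' : A} {n n' m m' : ℕ} (ha : a ∣ f ^ n) (ha' : a' ∣ f ^ n')
    (hb : b ∣ g ^ m) (hb' : b' ∣ g ^ m') (h : b * a = a' * b') :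
    ∃ u : Aˣ, a = u * a' := by
  have h1 : a ∣ a' := by
    refine koszul_nzd_mod hf hfg ha m' a' ?_
    obtain ⟨c, hc⟩ := hb'
    exact ⟨b * c, by rw [hc]; linear_combination -c * h⟩
  have h2 : a' ∣ a := by
    refine koszul_nzd_mod hf hfg ha' m a ?_
    obtain ⟨c, hc⟩ := hb
    exact ⟨b' * c, by rw [hc]; linear_combination c * h⟩
  obtain ⟨p, hp⟩ := h1
  obtain ⟨q, hq⟩ := h2
  have hfn : ∀ (n : ℕ) (y), f ^ n * y = 0 → y = 0 := by
    intro n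
    induction n with
    | zero => intro y hy; simpa using hy
    | succ n ih => intro y hy; exact ih _ (hf _ (by rw [← hy]; ring))
  obtain ⟨c, hc⟩ := ha
  have hqp : q * p = 1 := by
    refine (sub_eq_zero.mp (hfn n _ ?_))
    rw [hc]
    have : a = a * p * q := by rw [← hp]; exact hq
    linear_combination -c * this
  exact ⟨⟨q, p, hqp, by rw [mul_comm]; exact hqp⟩, by rw [hq]; ring⟩

lemma koszul_aseq_nzd {A : Type u} [CommRing A] {ι : Type w} [DecidableEq ι]
    {S : Finset ι} {f : ι → A} (hf : IsFamilyASeq S f) {k : ι} (hk : k ∈ S) :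
    ∀ y, f k * y = 0 → y = 0 := by
  have h := (hf (k :: (S.erase k).toList) (by simp [Finset.nodup_toList])
    (by simp [Finset.insert_erase hk])).2 ⟨0, by simp⟩
  simpa using h

lemma koszul_aseq_nzd2 {A : Type u} [CommRing A] {ι : Type w} [DecidableEq ι]
    {S : Finset ι} {f : ι → A} (hf : IsFamilyASeq S f) {k l : ι} (hk : k ∈ S) (hl : l ∈ S)
    (hkl : k ≠ l) : ∀ y, f k ∣ f l * y → f k ∣ y := by
  have hl' : l ∈ S.erase k := Finset.mem_erase.2 ⟨hkl.symm, hl⟩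
  have h := (hf (k :: l :: ((S.erase k).erase l).toList)
    (by simp [Finset.nodup_toList, hkl])
    (by simp [Finset.insert_erase hl', Finset.insert_erase hk])).2 ⟨1, by simp⟩
  simpa [Ideal.mem_span_singleton] using h

/-- Let `x` be a free Koszul `S`-cube over a commutative noetherian ring
`A` associated with an `A`-sequence `{f s}_{s ∈ S}`.  Then (1) all vertices of `x` have the
same rank, and (2) for any choice of bases of all vertices (necessarily over a common index
type, by (1)), so that every boundary map is represented by a square matrix and has a
determinant, for every `T ⊆ S` and `k ∈ T` there is a unit `u ∈ Aˣ` with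
`det d^k_S = u * det d^k_T`. -/
theorem free_koszul_cube_rank_and_det {A : Type u} [CommRing A] [IsNoetherianRing A]
    {ι : Type w} [DecidableEq ι] (S : Finset ι) (f : ι → A) (hf : IsFamilyASeq S f)
    (x : Cube (ModuleCat.{u} A) ι) (hx : IsKoszulCube x S f)
    (hfree : ∀ T ⊆ S, Module.Free A (x.vtx T)) :
    (∀ T ⊆ S, ∀ T' ⊆ S, Module.finrank A (x.vtx T) = Module.finrank A (x.vtx T')) ∧
    (∀ (κ : Type u) [Fintype κ] [DecidableEq κ]
      (b : ∀ T : Finset ι, T ⊆ S → Module.Basis κ A (x.vtx T)),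
      ∀ (T : Finset ι) (hT : T ⊆ S), ∀ k ∈ T, ∃ u : Aˣ,
        (LinearMap.toMatrix (b S (subset_refl S)) (b (S.erase k) (Finset.erase_subset k S))
            (x.bd S k).hom).det =
          (u : A) * (LinearMap.toMatrix (b T hT) (b (T.erase k) ((Finset.erase_subset k T).trans hT))
            (x.bd T k).hom).det) := by
  constructor
  · have step : ∀ T ⊆ S, ∀ k ∈ T,
        Module.finrank A (x.vtx T) = Module.finrank A (x.vtx (T.erase k)) := by
      intro T hT k hk
      have hT' := (Finset.erase_subset k T).trans hT
      obtain ⟨hinj, -, n, hn⟩ := hx.2 T hT k hk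
      have := (hx.1 T hT).1
      have := (hx.1 _ hT').1
      have := hfree T hT
      have := hfree _ hT'
      rcases subsingleton_or_nontrivial A with hA | hA
      · simp only [Module.finrank, rank_subsingleton]
      have c := Module.Free.chooseBasis A (x.vtx (T.erase k))
      obtain ⟨g, hg⟩ := koszul_exists_section c _ _ hn
      apply le_antisymm
      · exact LinearMap.finrank_le_finrank_of_injective (f := (x.bd T k).hom) hinj
      · refine LinearMap.finrank_le_finrank_of_injective (f := g) ?_
        have hz := koszul_aseq_nzd hf (hT hk)
        have hfn : ∀ (n : ℕ) (y), f k ^ n * y = 0 → y = 0 := by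
          intro n
          induction n with
          | zero => intro y hy; simpa using hy
          | succ n ih => intro y hy; exact ih _ (hz _ (by rw [← hy]; ring))
        rw [injective_iff_map_eq_zero]
        intro y hy
        have h1 : f k ^ n • y = 0 := by
          have := LinearMap.congr_fun hg y
          simpa [hy] using this.symm
        apply c.ext_elem
        intro i
        have := congrArg (fun z => c.repr z i) h1
        simp at this
        simpa using hfn n _ (by simpa using this)
    have all : ∀ T : Finset ι, T ⊆ S →
        Module.finrank A (x.vtx T) = Module.finrank A (x.vtx ∅) := by
      intro T
      induction T using Finset.induction_on with
      | empty => intro _; rfl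
      | insert k T hk ih =>
        intro hT
        rw [step _ hT k (Finset.mem_insert_self k T), Finset.erase_insert hk]
        exact ih ((Finset.subset_insert k T).trans hT)
    intro T hT T' hT'
    rw [all T hT, all T' hT']
  · intro κ _ _ b
    let D : ∀ T U : Finset ι, T ⊆ S → U ⊆ S → U ⊆ T → A := fun T U hT hU h =>
      (LinearMap.toMatrix (b T hT) (b U hU) (x.mapLE h).hom).det
    have Dmul : ∀ T U V hT hU hV (h1 : U ⊆ T) (h2 : V ⊆ U),
        D U V hU hV h2 * D T U hT hU h1 = D T V hT hV (h2.trans h1) := by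
      intro T U V hT hU hV h1 h2
      simp only [D]
      rw [← Matrix.det_mul, ← LinearMap.toMatrix_comp, ← x.mapLE_comp h1 h2]
      rfl
    have Ddvd : ∀ T U hT hU h, ∀ k ∈ T, U = T.erase k → ∃ n : ℕ, D T U hT hU h ∣ f k ^ n := by
      rintro T U hT hU h k hk rfl
      exact koszul_det_dvd _ _ _ _ (hx.2 T hT k hk).2.2
    have main : ∀ (n : ℕ) (T : Finset ι) (hT : T ⊆ S) (k : ι), k ∈ T → (S \ T).card = n →
        ∃ u : Aˣ, D S (S.erase k) subset_rfl (Finset.erase_subset k S) (Finset.erase_subset k S) =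
          u * D T (T.erase k) hT ((Finset.erase_subset k T).trans hT)
            (Finset.erase_subset k T) := by
      intro n
      induction n with
      | zero =>
        intro T hT k hk hc
        obtain rfl : T = S := subset_antisymm hT (by simpa [Finset.sdiff_eq_empty_iff_subset] using hc)
        exact ⟨1, by simp⟩
      | succ n ih =>
        intro T hT k hk hc
        obtain ⟨l, hl⟩ : (S \ T).Nonempty := by
          rw [← Finset.card_pos]; omega
        obtain ⟨hlS, hlT⟩ := Finset.mem_sdiff.1 hl
        have hkl : k ≠ l := fun h => hlT (h ▸ hk)
        have hT' : insert l T ⊆ S := Finset.insert_subset hlS hT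
        have hk' : k ∈ insert l T := Finset.mem_insert_of_mem hk
        obtain ⟨u, hu⟩ := ih (insert l T) hT' k hk' (by
          rw [Finset.sdiff_insert, Finset.card_erase_of_mem hl]; omega)
        have e1 : T = (insert l T).erase l := (Finset.erase_insert hlT).symm
        have e2 : T.erase k = ((insert l T).erase k).erase l := by
          rw [Finset.erase_right_comm, ← e1]
        have s1 : T ⊆ insert l T := Finset.subset_insert l T
        have s2 : T.erase k ⊆ (insert l T).erase k := Finset.erase_subset_erase k s1
        have hTk' := (Finset.erase_subset k (insert l T)).trans hT'
        have hTk := (Finset.erase_subset k T).trans hT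
        obtain ⟨n1, h1⟩ := Ddvd (insert l T) _ hT' hTk' (Finset.erase_subset k _) k hk' rfl
        obtain ⟨n2, h2⟩ := Ddvd T _ hT hTk (Finset.erase_subset k _) k hk rfl
        obtain ⟨n3, h3⟩ := Ddvd _ _ hTk' hTk s2 l (by simp [hkl.symm]) e2
        obtain ⟨n4, h4⟩ := Ddvd _ _ hT' hT s1 l (by simp) e1
        obtain ⟨v, hv⟩ := koszul_assoc (koszul_aseq_nzd hf (hT hk))
          (koszul_aseq_nzd2 hf (hT hk) hlS hkl) h1 h2 h3 h4
          ((Dmul _ _ _ _ _ _ _ _).trans (Dmul _ _ _ _ _ _ _ _).symm)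
        exact ⟨u * v, by rw [hu, hv, Units.val_mul, mul_assoc]⟩
    intro T hT k hk
    exact main _ T hT k hk rfl
end

section
/- Let x be a Koszul S-cube over a commutative noetherian ring A associated with an A-sequence {f_s}_{s∈S}. If for some T ⊆ S and some t ∈ T the boundary morphism d_T^{x,t} is an isomorphism, then x is degenerate along the t-direction, i.e., d_U^{x,t} is an isomorphism for every U ⊆ S with t ∈ U. -/
open CategoryTheory CategoryTheory.Limits Opposite

attribute [local instance] CategoryTheory.Abelian.hasFiniteBiproducts

set_option linter.unusedSectionVars false

universe w v u

lemma koszul_pow_cancel {A : Type*} [CommRing A] {s t : A}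
    (ht : ∀ x : A, t * x = 0 → x = 0)
    (hs : ∀ x : A, t ∣ s * x → t ∣ x) (N M : ℕ) (x : A)
    (h : t ^ N ∣ s ^ M * x) : t ^ N ∣ x := by
  have h1 : ∀ (N : ℕ) (x : A), t ^ N ∣ s * x → t ^ N ∣ x := by
    intro N
    induction N with
    | zero => intro x _; simp
    | succ N ih =>
      rintro x ⟨y, hy⟩
      obtain ⟨z, rfl⟩ := hs x ⟨t ^ N * y, by rw [hy]; ring⟩
      have h2 : s * z = t ^ N * y := by
        rw [← sub_eq_zero]
        apply ht
        linear_combination hy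
      obtain ⟨w, rfl⟩ := ih z ⟨y, h2⟩
      exact ⟨w, by ring⟩
  induction M with
  | zero => simpa using h
  | succ M ih =>
    apply ih
    apply h1
    convert h using 1
    ring

lemma koszul_proj_cancel {A : Type*} [CommRing A] {P : Type*} [AddCommGroup P] [Module A P]
    [Module.Projective A P] {a b : A} (hab : ∀ x : A, a ∣ b * x → a ∣ x) (p q : P)
    (h : b • p = a • q) : ∃ r : P, p = a • r := by
  obtain ⟨σ, hσ⟩ := Module.projective_def'.1 (inferInstance : Module.Projective A P)
  have h1 : ∀ i, ∃ c, σ p i = a * c := by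
    intro i
    have := congrArg (fun z => σ z i) h
    simp only [map_smul, Finsupp.smul_apply, smul_eq_mul] at this
    exact hab _ ⟨_, this⟩
  choose c hc using h1
  have h2 : σ p = a • ∑ i ∈ (σ p).support, Finsupp.single i (c i) := by
    conv_lhs => rw [← Finsupp.sum_single (σ p)]
    rw [Finsupp.sum, Finset.smul_sum]
    refine Finset.sum_congr rfl fun i _ => ?_
    rw [Finsupp.smul_single, smul_eq_mul, ← hc]
  have h3 : Finsupp.linearCombination A id (σ p) = p := LinearMap.congr_fun hσ p
  rw [h2, map_smul] at h3
  exact ⟨_, h3.symm⟩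

lemma koszul_proj_nzd {A : Type*} [CommRing A] {P : Type*} [AddCommGroup P] [Module A P]
    [Module.Projective A P] {a : A} (ha : ∀ x : A, a * x = 0 → x = 0) (p : P)
    (h : a • p = 0) : p = 0 := by
  obtain ⟨σ, hσ⟩ := Module.projective_def'.1 (inferInstance : Module.Projective A P)
  have h3 : Finsupp.linearCombination A id (σ p) = p := LinearMap.congr_fun hσ p
  have : σ p = 0 := by
    ext i
    have := congrArg (fun z => σ z i) h
    simp only [map_smul, Finsupp.smul_apply, smul_eq_mul, map_zero, Finsupp.zero_apply] at this
    exact ha _ this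
  rw [← h3, this, map_zero]

/-- A monomorphism of projectives whose cokernel is killed by powers of a regular pair is onto. -/
lemma koszul_surj {A : Type*} [CommRing A] {P Q : Type*} [AddCommGroup P] [Module A P]
    [AddCommGroup Q] [Module A Q] [Module.Projective A P] [Module.Projective A Q] {s t : A}
    (ht : ∀ x : A, t * x = 0 → x = 0) (hs : ∀ x : A, t ∣ s * x → t ∣ x)
    (D : P →ₗ[A] Q) (hD : Function.Injective D) (N M : ℕ)
    (h1 : ∀ q, ∃ p, D p = t ^ N • q) (h2 : ∀ q, ∃ p, D p = s ^ M • q) :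
    Function.Surjective D := by
  intro q
  obtain ⟨p1, hp1⟩ := h1 q
  obtain ⟨p2, hp2⟩ := h2 q
  have h : s ^ M • p1 = t ^ N • p2 := by
    apply hD
    rw [map_smul, map_smul, hp1, hp2, smul_comm]
  obtain ⟨r, rfl⟩ := koszul_proj_cancel (koszul_pow_cancel ht hs N M) p1 p2 h
  have htN : ∀ x : A, t ^ N * x = 0 → x = 0 := by
    clear * - ht
    induction N with
    | zero => simp
    | succ N ih =>
      intro x hx
      apply ht; apply ih; rw [← hx]; ring
  refine ⟨r, ?_⟩
  rw [← sub_eq_zero]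
  apply koszul_proj_nzd htN
  rw [smul_sub, ← map_smul, hp1, sub_self]

lemma koszul_aseq_pair {A : Type u} [CommRing A] {ι : Type w} [DecidableEq ι]
    {S : Finset ι} {f : ι → A} (hf : IsFamilyASeq S f) {s t : ι} (hs : s ∈ S) (ht : t ∈ S)
    (hst : s ≠ t) :
    (∀ x : A, f t * x = 0 → x = 0) ∧ (∀ x : A, f t ∣ f s * x → f t ∣ x) := by
  obtain ⟨-, h⟩ := hf (t :: s :: ((S.erase t).erase s).toList)
    (by simp [Finset.nodup_toList, hst.symm])
    (by ext i; simp; grind)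
  refine ⟨fun x hx => ?_, fun x hx => ?_⟩
  · have := h ⟨0, by simp⟩ x (by simp [hx])
    simpa using this
  · have := h ⟨1, by simp⟩ x (by simpa [Ideal.mem_span_singleton] using hx)
    simpa [Ideal.mem_span_singleton] using this

lemma koszul_data {A : Type u} [CommRing A] {ι : Type w} [DecidableEq ι] {S : Finset ι} {f : ι → A}
    {x : Cube (ModuleCat.{u} A) ι} (hx : IsKoszulCube x S f) {U V : Finset ι} {k : ι}
    (hU : U ⊆ S) (hk : k ∈ U) (hV : U.erase k = V) (h : V ⊆ U) :
    Function.Injective (x.mapLE h).hom ∧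
      ∃ n : ℕ, ∀ q, ∃ p, (x.mapLE h).hom p = f k ^ n • q := by
  subst hV
  obtain ⟨h1, -, n, hn⟩ := hx.2 U hU k hk
  refine ⟨h1, n, fun q => ?_⟩
  have := hn (Submodule.Quotient.mk q)
  rw [← Submodule.Quotient.mk_smul, Submodule.Quotient.mk_eq_zero] at this
  exact this

lemma koszul_step {A : Type u} [CommRing A] {ι : Type w} [DecidableEq ι] {S : Finset ι} {f : ι → A}
    (hf : IsFamilyASeq S f) {x : Cube (ModuleCat.{u} A) ι} (hx : IsKoszulCube x S f)
    {s t : ι} (hst : s ≠ t) (V : Finset ι) (hs : s ∉ V) (ht : t ∉ V) (hV : V ⊆ S)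
    (hsS : s ∈ S) (htS : t ∈ S) :
    Function.Surjective (x.mapLE (Finset.subset_insert t (insert s V))).hom ↔
      Function.Surjective (x.mapLE (Finset.subset_insert t V)).hom := by
  have hsV : insert s V ⊆ S := Finset.insert_subset hsS hV
  have htV : insert t V ⊆ S := Finset.insert_subset htS hV
  have htsV : insert t (insert s V) ⊆ S := Finset.insert_subset htS hsV
  have hE : insert t V ⊆ insert t (insert s V) :=
    Finset.insert_subset_insert _ (Finset.subset_insert _ _)
  obtain ⟨hr1, hr2⟩ := koszul_aseq_pair hf hsS htS hst
  obtain ⟨iD, n1, hD⟩ := koszul_data hx (k := t) htsV (by simp) (by grind)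
    (Finset.subset_insert t (insert s V))
  obtain ⟨iD', n2, hD'⟩ := koszul_data hx (k := t) htV (by simp) (by grind)
    (Finset.subset_insert t V)
  obtain ⟨iE, n3, hE3⟩ := koszul_data hx (k := s) htsV (by simp) (by grind) hE
  obtain ⟨iE', n4, hE4⟩ := koszul_data hx (k := s) hsV (by simp) (by grind)
    (Finset.subset_insert s V)
  have comm : ∀ p, (x.mapLE (Finset.subset_insert t V)).hom ((x.mapLE hE).hom p) =
      (x.mapLE (Finset.subset_insert s V)).hom
        ((x.mapLE (Finset.subset_insert t (insert s V))).hom p) := by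
    intro p
    have h := (x.mapLE_comp hE (Finset.subset_insert t V)).trans
      (x.mapLE_comp (Finset.subset_insert t (insert s V)) (Finset.subset_insert s V)).symm
    exact LinearMap.congr_fun (congrArg ModuleCat.Hom.hom h) p
  have := (hx.1 _ hV).2
  have := (hx.1 _ hsV).2
  have := (hx.1 _ htV).2
  have := (hx.1 _ htsV).2
  constructor
  · intro hsurj
    refine koszul_surj hr1 hr2 _ iD' n2 n4 hD' fun q => ?_
    obtain ⟨y, hy⟩ := hE4 q
    obtain ⟨p, rfl⟩ := hsurj y
    exact ⟨_, (comm p).trans hy⟩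
  · intro hsurj
    refine koszul_surj hr1 hr2 _ iD n1 n3 hD fun q => ?_
    obtain ⟨y, hy⟩ := hsurj ((x.mapLE (Finset.subset_insert s V)).hom q)
    obtain ⟨p, hp⟩ := hE3 y
    refine ⟨p, iE' ?_⟩
    rw [← comm, hp, map_smul, map_smul, hy]

lemma koszul_all {A : Type u} [CommRing A] {ι : Type w} [DecidableEq ι] {S : Finset ι} {f : ι → A}
    (hf : IsFamilyASeq S f) {x : Cube (ModuleCat.{u} A) ι} (hx : IsKoszulCube x S f)
    {t : ι} (htS : t ∈ S) (V : Finset ι) (hV : V ⊆ S) (ht : t ∉ V) :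
    Function.Surjective (x.mapLE (Finset.subset_insert t V)).hom ↔
      Function.Surjective (x.mapLE (Finset.subset_insert t ∅)).hom := by
  induction V using Finset.induction_on with
  | empty => rfl
  | insert s V hs ih =>
    have hV' : V ⊆ S := (Finset.subset_insert _ _).trans hV
    rw [← ih hV' (by grind)]
    exact koszul_step hf hx (by grind) V hs (by grind) hV' (by grind) htS

lemma koszul_iso_iff {A : Type u} [CommRing A] {ι : Type w} [DecidableEq ι] {S : Finset ι}
    {f : ι → A} {x : Cube (ModuleCat.{u} A) ι} (hx : IsKoszulCube x S f)
    {t : ι} (U : Finset ι) (hU : U ⊆ S) (ht : t ∈ U) :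
    IsIso (x.bd U t) ↔
      Function.Surjective (x.mapLE (Finset.subset_insert t (U.erase t))).hom := by
  have key : ∀ (W : Finset ι) (hW : W = U) (h : U.erase t ⊆ W),
      IsIso (x.bd U t) ↔ Function.Surjective (x.mapLE h).hom := by
    rintro W rfl h
    rw [ConcreteCategory.isIso_iff_bijective]
    exact ⟨fun h => h.2, fun h => ⟨(hx.2 W hU t ht).1, h⟩⟩
  exact key _ (Finset.insert_erase ht) _

/-- Let `x` be a Koszul `S`-cube over a commutative noetherian ring `A`
associated with an `A`-sequence `{f s}_{s ∈ S}`.  If for some `T ⊆ S` and `t ∈ T` the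
boundary morphism `d^t_T` is an isomorphism, then `x` is degenerate along the
`t`-direction: `d^t_U` is an isomorphism for every `U ⊆ S` containing `t`. -/
theorem koszul_cube_degenerate_direction {A : Type u} [CommRing A] [IsNoetherianRing A]
    {ι : Type w} [DecidableEq ι] (S : Finset ι) (f : ι → A) (hf : IsFamilyASeq S f)
    (x : Cube (ModuleCat.{u} A) ι) (hx : IsKoszulCube x S f)
    (T : Finset ι) (hT : T ⊆ S) (t : ι) (ht : t ∈ T) (hiso : IsIso (x.bd T t)) :
    ∀ U ⊆ S, t ∈ U → IsIso (x.bd U t) := by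
  intro U hU htU
  rw [koszul_iso_iff hx U hU htU,
    koszul_all hf hx (hU htU) _ ((Finset.erase_subset _ _).trans hU) (Finset.notMem_erase _ _)]
  rwa [koszul_iso_iff hx T hT ht,
    koszul_all hf hx (hU htU) _ ((Finset.erase_subset _ _).trans hT) (Finset.notMem_erase _ _)]
    at hiso
end

section
/- Let x be a non-degenerate free Koszul S-cube over a commutative noetherian ring A associated with an A-sequence {f_s}_{s∈S}, and fix bases of all vertices of x. Then the determinant det x = {det d_S^{x,s}}_{s∈S} is an A-sequence. -/
open CategoryTheory CategoryTheory.Limits Opposite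

attribute [local instance] CategoryTheory.Abelian.hasFiniteBiproducts

set_option linter.unusedSectionVars false

universe w v u

open RingTheory.Sequence Function Pointwise in
/-- If `0 → P → E → Q → 0` is exact and `r` is regular on `Q`, it stays exact modulo `r`. -/
lemma ses_quot {R P E Q : Type*} [CommRing R] [AddCommGroup P] [AddCommGroup E] [AddCommGroup Q]
    [Module R P] [Module R E] [Module R Q] {f : P →ₗ[R] E} {g : E →ₗ[R] Q}
    (h : Injective f ∧ Exact f g ∧ Surjective g) {r : R} (hr : IsSMulRegular Q r) :
    Injective (QuotSMulTop.map r f) ∧ Exact (QuotSMulTop.map r f) (QuotSMulTop.map r g) ∧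
      Surjective (QuotSMulTop.map r g) := by
  obtain ⟨hf, hfg, hg⟩ := h
  refine ⟨?_, QuotSMulTop.map_exact r hfg hg, QuotSMulTop.map_surjective r hg⟩
  rw [injective_iff_map_eq_zero]
  intro p hp
  obtain ⟨p, rfl⟩ := Submodule.Quotient.mk_surjective _ p
  rw [QuotSMulTop.map_apply_mk, Submodule.Quotient.mk_eq_zero,
    Submodule.mem_smul_pointwise_iff_exists] at hp
  obtain ⟨e, -, he⟩ := hp
  have h1 : g e = 0 := by
    apply hr
    show r • g e = r • (0 : Q)
    rw [← map_smul, he, hfg.apply_apply_eq_zero, smul_zero]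
  obtain ⟨p', rfl⟩ := (hfg e).1 h1
  rw [← map_smul] at he
  rw [Submodule.Quotient.mk_eq_zero, ← hf he]
  exact Submodule.smul_mem_pointwise_smul _ _ _ trivial

open RingTheory.Sequence Function Pointwise in
/-- Multiplication by `a` gives `0 → M/bM → M/abM → M/aM → 0`. -/
lemma ses_mul {R M : Type*} [CommRing R] [AddCommGroup M] [Module R M] {a : R} (b : R)
    (ha : IsSMulRegular M a) :
    ∃ (f : QuotSMulTop b M →ₗ[R] QuotSMulTop (a * b) M)
      (g : QuotSMulTop (a * b) M →ₗ[R] QuotSMulTop a M),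
      Injective f ∧ Exact f g ∧ Surjective g := by
  refine ⟨Submodule.mapQ _ _ (LinearMap.lsmul R M a) ?_, Submodule.mapQ _ _ LinearMap.id ?_,
    ?_, ?_, ?_⟩
  · intro m hm
    obtain ⟨m', -, rfl⟩ := (Submodule.mem_smul_pointwise_iff_exists _ _ _).1 hm
    simp only [Submodule.mem_comap, LinearMap.lsmul_apply, smul_smul]
    exact Submodule.smul_mem_pointwise_smul _ _ _ trivial
  · intro m hm
    obtain ⟨m', -, rfl⟩ := (Submodule.mem_smul_pointwise_iff_exists _ _ _).1 hm
    simp only [Submodule.mem_comap, LinearMap.id_apply, mul_smul]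
    exact Submodule.smul_mem_pointwise_smul _ _ _ trivial
  · rw [injective_iff_map_eq_zero]
    intro p hp
    obtain ⟨p, rfl⟩ := Submodule.Quotient.mk_surjective _ p
    rw [Submodule.mapQ_apply, Submodule.Quotient.mk_eq_zero,
      Submodule.mem_smul_pointwise_iff_exists] at hp
    obtain ⟨e, -, he⟩ := hp
    rw [mul_smul] at he
    rw [Submodule.Quotient.mk_eq_zero, ← ha he]
    exact Submodule.smul_mem_pointwise_smul _ _ _ trivial
  · intro y
    obtain ⟨y, rfl⟩ := Submodule.Quotient.mk_surjective _ y
    rw [Submodule.mapQ_apply, Submodule.Quotient.mk_eq_zero,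
      Submodule.mem_smul_pointwise_iff_exists]
    constructor
    · rintro ⟨m, -, hm⟩
      refine ⟨Submodule.Quotient.mk m, ?_⟩
      rw [Submodule.mapQ_apply]
      exact congrArg _ hm
    · rintro ⟨m, hm⟩
      obtain ⟨m, rfl⟩ := Submodule.Quotient.mk_surjective _ m
      rw [Submodule.mapQ_apply, Submodule.Quotient.eq,
        Submodule.mem_smul_pointwise_iff_exists] at hm
      obtain ⟨e, -, he⟩ := hm
      refine ⟨m - b • e, trivial, ?_⟩
      rw [smul_sub, smul_smul, he]
      simp
  · intro y
    obtain ⟨y, rfl⟩ := Submodule.Quotient.mk_surjective _ y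
    exact ⟨Submodule.Quotient.mk y, rfl⟩

open RingTheory.Sequence Function Pointwise in
/-- Weak regularity passes to extensions. -/
lemma wreg_ext {R : Type*} [CommRing R] (rs : List R) : ∀ {P E Q : Type u}
    [AddCommGroup P] [AddCommGroup E] [AddCommGroup Q]
    [Module R P] [Module R E] [Module R Q] {f : P →ₗ[R] E} {g : E →ₗ[R] Q}
    (_ : Injective f ∧ Exact f g ∧ Surjective g) (_ : IsWeaklyRegular P rs)
    (_ : IsWeaklyRegular Q rs), IsWeaklyRegular E rs := by
  induction rs with
  | nil => intros; exact IsWeaklyRegular.nil _ _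
  | cons r rs ih =>
    intro P E Q _ _ _ _ _ _ f g h hP hQ
    rw [isWeaklyRegular_cons_iff] at hP hQ ⊢
    exact ⟨isSMulRegular_of_range_eq_ker h.1 (LinearMap.exact_iff.1 h.2.1).symm hP.1 hQ.1,
      ih (ses_quot h hQ.1) hP.2 hQ.2⟩

open RingTheory.Sequence Function Pointwise in
/-- Weak regularity descends from an object which is an extension both ways. -/
lemma wreg_two_ext {R : Type*} [CommRing R] (rs : List R) : ∀ {P E Q : Type u}
    [AddCommGroup P] [AddCommGroup E] [AddCommGroup Q]
    [Module R P] [Module R E] [Module R Q] {f : P →ₗ[R] E} {g : E →ₗ[R] Q}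
    {f' : Q →ₗ[R] E} {g' : E →ₗ[R] P}
    (_ : Injective f ∧ Exact f g ∧ Surjective g) (_ : Injective f' ∧ Exact f' g' ∧ Surjective g')
    (_ : IsWeaklyRegular E rs), IsWeaklyRegular P rs := by
  induction rs with
  | nil => intros; exact IsWeaklyRegular.nil _ _
  | cons r rs ih =>
    intro P E Q _ _ _ _ _ _ f g f' g' h h' hE
    rw [isWeaklyRegular_cons_iff] at hE ⊢
    have hP : IsSMulRegular P r := hE.1.of_injective f h.1
    have hQ : IsSMulRegular Q r := hE.1.of_injective f' h'.1
    exact ⟨hP, ih (ses_quot h hQ) (ses_quot h' hP) hE.2⟩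

open RingTheory.Sequence Function Pointwise in
lemma wreg_pow {R : Type*} [CommRing R] {M : Type u} [AddCommGroup M] [Module R M] {a : R}
    {rs : List R} (ha : IsSMulRegular M a) (h : IsWeaklyRegular (QuotSMulTop a M) rs) (n : ℕ) :
    IsWeaklyRegular (QuotSMulTop (a ^ n) M) rs := by
  induction n with
  | zero =>
    have hs : Subsingleton (QuotSMulTop (a ^ 0) M) := by
      rw [Submodule.Quotient.subsingleton_iff, pow_zero, one_smul]
    exact ⟨fun i hi => fun x y _ => Subsingleton.elim _ _⟩
  | succ n ih =>
    rw [pow_succ']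
    obtain ⟨f, g, hfg⟩ := ses_mul (a ^ n) ha
    exact wreg_ext rs hfg ih h

open RingTheory.Sequence Function Pointwise in
lemma wreg_dvd {R : Type*} [CommRing R] {M : Type u} [AddCommGroup M] [Module R M] {a d : R}
    {rs : List R} {n : ℕ} (hd : d ∣ a ^ n) (h : IsWeaklyRegular M (a :: rs)) :
    IsWeaklyRegular M (d :: rs) := by
  rw [isWeaklyRegular_cons_iff] at h ⊢
  obtain ⟨e, he⟩ := hd
  have h1 : IsSMulRegular M (d * e) := he ▸ h.1.pow n
  have hd : IsSMulRegular M d := IsSMulRegular.of_mul (a := e) (by rwa [mul_comm])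
  have he' : IsSMulRegular M e := IsSMulRegular.of_mul h1
  refine ⟨hd, ?_⟩
  have h2 := wreg_pow h.1 h.2 n
  rw [he] at h2
  obtain ⟨f, g, hfg⟩ := ses_mul e hd
  have h3 := ses_mul d he'
  rw [mul_comm e d] at h3
  obtain ⟨f', g', hfg'⟩ := h3
  exact wreg_two_ext rs hfg' hfg h2

open RingTheory.Sequence in
lemma wreg_map_dvd {R : Type*} [CommRing R] {ι : Type*} (f d : ι → R) (l : List ι) :
    ∀ {M : Type u} [AddCommGroup M] [Module R M] (_ : ∀ i ∈ l, ∃ n : ℕ, d i ∣ f i ^ n)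
    (_ : IsWeaklyRegular M (l.map f)), IsWeaklyRegular M (l.map d) := by
  induction l with
  | nil => intros; exact IsWeaklyRegular.nil _ _
  | cons i l ih =>
    intro M _ _ hd h
    obtain ⟨n, hn⟩ := hd i (by simp)
    have h1 := wreg_dvd hn h
    rw [isWeaklyRegular_cons_iff] at h1
    exact .cons h1.1 (ih (fun j hj => hd j (by simp [hj])) h1.2)

open RingTheory.Sequence in
lemma wreg_iff {R : Type u} [CommRing R] (fs : List R) : IsWeaklyRegular R fs ↔
    ∀ i : Fin fs.length, ∀ x : R,
    fs.get i * x ∈ Ideal.span {y | y ∈ fs.take i.1} →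
    x ∈ Ideal.span {y | y ∈ fs.take i.1} := by
  rw [isWeaklyRegular_iff_Fin]
  refine forall_congr' fun i => ?_
  rw [isSMulRegular_quotient_iff_mem_of_smul_mem]
  simp only [Ideal.smul_eq_mul, Ideal.mul_top, smul_eq_mul]
  rfl

open Module in
lemma det_dvd_pow {A : Type*} [CommRing A] {V W κ : Type*} [AddCommGroup V] [AddCommGroup W]
    [Module A V] [Module A W] [Fintype κ] [DecidableEq κ] (bV : Basis κ A V) (bW : Basis κ A W)
    (φ : V →ₗ[A] W) (a : A) (n : ℕ) (h : ∀ m : W ⧸ LinearMap.range φ, a ^ n • m = 0) :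
    ∃ N : ℕ, (LinearMap.toMatrix bV bW φ).det ∣ a ^ N := by
  have h1 : ∀ w : W, ∃ v : V, φ v = a ^ n • w := by
    intro w
    have := h (Submodule.Quotient.mk w)
    rw [← Submodule.Quotient.mk_smul, Submodule.Quotient.mk_eq_zero] at this
    exact this
  choose g hg using h1
  let ψ : W →ₗ[A] V := bW.constr A (fun i => g (bW i))
  have h2 : φ ∘ₗ ψ = a ^ n • LinearMap.id := by
    refine bW.ext fun i => ?_
    simp [ψ, Basis.constr_basis, hg]
  refine ⟨n * Fintype.card κ, (LinearMap.toMatrix bW bV ψ).det, ?_⟩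
  rw [← Matrix.det_mul, ← LinearMap.toMatrix_comp, h2, map_smul, LinearMap.toMatrix_id,
    Matrix.det_smul, Matrix.det_one, mul_one, pow_mul]

/-- Let `x` be a non-degenerate free Koszul `S`-cube over a commutative
noetherian ring `A` associated with an `A`-sequence `{f s}_{s ∈ S}`, with chosen bases of
all vertices.  Then the determinant `det x = {det d^s_S}_{s ∈ S}` is an `A`-sequence, i.e.
every enumeration of `S` yields an `A`-regular sequence of determinants. -/
theorem det_of_nondegenerate_free_koszul_cube_is_ASeq {A : Type u} [CommRing A]
    [IsNoetherianRing A] {ι : Type w} [DecidableEq ι] (S : Finset ι) (f : ι → A)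
    (hf : IsFamilyASeq S f) (x : Cube (ModuleCat.{u} A) ι) (hx : IsKoszulCube x S f)
    (hfree : ∀ T ⊆ S, Module.Free A (x.vtx T))
    (hnd : ∀ T ⊆ S, ∀ k ∈ T, ¬ IsIso (x.bd T k))
    (κ : Type u) [Fintype κ] [DecidableEq κ]
    (b : ∀ T : Finset ι, T ⊆ S → Module.Basis κ A (x.vtx T)) :
    ∀ l : List ι, l.Nodup → l.toFinset = S →
      IsRegularSeq (l.map (fun s =>
        (LinearMap.toMatrix (b S (subset_refl S)) (b (S.erase s) (Finset.erase_subset s S))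
          (x.bd S s).hom).det)) := by
  intro l hl hlS
  constructor
  · intro d hd hu
    obtain ⟨s, hs, rfl⟩ := List.mem_map.1 hd
    have hsS : s ∈ S := by rw [← hlS]; simpa using hs
    apply hnd S (subset_refl S) s hsS
    rw [ConcreteCategory.isIso_iff_bijective]
    exact (LinearEquiv.ofIsUnitDet hu).bijective
  · rw [← wreg_iff]
    refine wreg_map_dvd f _ l ?_ ((wreg_iff _).2 (hf l hl hlS).2)
    intro s hs
    have hsS : s ∈ S := by rw [← hlS]; simpa using hs
    obtain ⟨-, -, n, hn⟩ := hx.2 S (subset_refl S) s hsS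
    exact det_dvd_pow _ _ _ (f s) n hn
end

section
/- For any non-degenerate free Koszul S-cube x over a commutative noetherian ring A (associated with an A-sequence {f_s}_{s∈S}), the total complex Tot x is 0-spherical, i.e., H_k(Tot x) = 0 for all k ≠ 0. -/
open CategoryTheory CategoryTheory.Limits Opposite

attribute [local instance] CategoryTheory.Abelian.hasFiniteBiproducts

set_option linter.unusedSectionVars false

universe w v u

/-- The differential `(Tot x)_{n+1} →ₗ (Tot x)_n` of the total complex of an `S`-cube of
`A`-modules, where `(Tot x)_n = ⊕_{T ⊆ S, #T = n} x_T`: its component from `x_T` to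
`x_{T ∖ {j}}` (for `j ∈ T`) is `(-1)^{#{t ∈ T | t > j}} ⬝ d^j_T`. -/
noncomputable def totDmod {A : Type u} [CommRing A] {ι : Type w} [LinearOrder ι]
    (x : Cube (ModuleCat.{u} A) ι) (S : Finset ι) (n : ℕ) :
    (DirectSum {T : Finset ι // T ∈ Finset.powersetCard (n+1) S} (fun T => x.vtx T.1)) →ₗ[A]
    (DirectSum {T : Finset ι // T ∈ Finset.powersetCard n S} (fun T => x.vtx T.1)) :=
  DirectSum.toModule A _ _ fun T =>
    ∑ j ∈ T.1.attach, ((-1 : A) ^ (T.1.filter (fun t => j.1 < t)).card) •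
      ((DirectSum.lof A {T' : Finset ι // T' ∈ Finset.powersetCard n S} (fun T' => x.vtx T'.1)
          ⟨T.1.erase j.1, by
            rcases Finset.mem_powersetCard.mp T.2 with ⟨hsub, hcard⟩
            exact Finset.mem_powersetCard.mpr ⟨(Finset.erase_subset _ _).trans hsub, by
              rw [Finset.card_erase_of_mem j.2, hcard]; rfl⟩⟩).comp
        ((x.bd T.1 j.1).hom : x.vtx T.1 →ₗ[A] x.vtx (T.1.erase j.1)))

namespace KoszulAux

variable {A : Type u} [CommRing A] {ι : Type w} [LinearOrder ι]

/-- structure map as a linear map -/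
noncomputable def mp (x : Cube (ModuleCat.{u} A) ι) {T U : Finset ι} (h : U ⊆ T) :
    x.vtx T →ₗ[A] x.vtx U := (x.mapLE h).hom

lemma mp_mp (x : Cube (ModuleCat.{u} A) ι) {T U V : Finset ι} (h1 : U ⊆ T) (h2 : V ⊆ U)
    (m : x.vtx T) : mp x h2 (mp x h1 m) = mp x (h2.trans h1) m := by
  have := x.mapLE_comp h1 h2
  simp only [mp, ← this]
  rfl

lemma mp_self (x : Cube (ModuleCat.{u} A) ι) {T : Finset ι} (h : T ⊆ T)
    (m : x.vtx T) : mp x h m = m := by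
  have := x.mapLE_refl T h
  simp only [mp, this]
  rfl

lemma mp_congr (x : Cube (ModuleCat.{u} A) ι) (c : ∀ T, x.vtx T) {T T' U : Finset ι}
    (e : T = T') (h : U ⊆ T) (h' : U ⊆ T') : mp x h (c T) = mp x h' (c T') := by
  subst e; rfl

/-- differential on families -/
noncomputable def D (x : Cube (ModuleCat.{u} A) ι) (S : Finset ι) (c : ∀ T, x.vtx T)
    (U : Finset ι) : x.vtx U :=
  ∑ j ∈ S \ U, ((-1 : A) ^ (U.filter (fun t => j < t)).card) •
    mp x (Finset.subset_insert j U) (c (insert j U))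

lemma D_congr (x : Cube (ModuleCat.{u} A) ι) (S : Finset ι) (c c' : ∀ T, x.vtx T)
    (U : Finset ι) (h : ∀ j ∈ S, j ∉ U → c (insert j U) = c' (insert j U)) :
    D x S c U = D x S c' U := by
  unfold D
  refine Finset.sum_congr rfl fun j hj => ?_
  rw [Finset.mem_sdiff] at hj
  rw [h j hj.1 hj.2]

lemma D_add (x : Cube (ModuleCat.{u} A) ι) (S : Finset ι) (c c' : ∀ T, x.vtx T)
    (U : Finset ι) : D x S (fun T => c T + c' T) U = D x S c U + D x S c' U := by
  simp [D, Finset.sum_add_distrib]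

lemma D_smul (x : Cube (ModuleCat.{u} A) ι) (S : Finset ι) (a : A) (c : ∀ T, x.vtx T)
    (U : Finset ι) : D x S (fun T => a • c T) U = a • D x S c U := by
  simp only [D, map_smul, Finset.smul_sum]
  exact Finset.sum_congr rfl fun j _ => smul_comm _ _ _

lemma D_neg (x : Cube (ModuleCat.{u} A) ι) (S : Finset ι) (c : ∀ T, x.vtx T)
    (U : Finset ι) : D x S (fun T => - c T) U = - D x S c U := by
  simp [D]

/-- The face of `x` consisting of the vertices containing `k`. -/
def face (k : ι) (x : Cube (ModuleCat.{u} A) ι) : Cube (ModuleCat.{u} A) ι where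
  obj T := x.obj (op (insert k T.unop))
  map g := x.map (homOfLE (Finset.insert_subset_insert k (leOfHom g.unop))).op
  map_id T := x.map_id _
  map_comp g h := by
    rw [← x.map_comp]; rfl

/-- restriction of a family to the face -/
def fres (k : ι) (x : Cube (ModuleCat.{u} A) ι) (c : ∀ T, x.vtx T) :
    ∀ T, (face k x).vtx T := fun T => c (insert k T)

/-- identity, as a linear map from the vertex of the face to the vertex of the cube -/
def fid (k : ι) (x : Cube (ModuleCat.{u} A) ι) (T : Finset ι) :
    (face k x).vtx T →ₗ[A] x.vtx (insert k T) := LinearMap.id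

lemma fid_mp (k : ι) (x : Cube (ModuleCat.{u} A) ι) {T U : Finset ι} (h : U ⊆ T)
    (m : (face k x).vtx T) : fid k x U (mp (face k x) h m) =
      mp x (Finset.insert_subset_insert k h) (fid k x T m) := rfl

lemma fid_inj (k : ι) (x : Cube (ModuleCat.{u} A) ι) (T : Finset ι) :
    Function.Injective (fid k x T) := fun _ _ h => h

/-- the edge map in direction `k` -/
noncomputable def ed (k : ι) (x : Cube (ModuleCat.{u} A) ι) (T : Finset ι) :
    (face k x).vtx T →ₗ[A] x.vtx T := (mp x (Finset.subset_insert k T)).comp (fid k x T)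

lemma ed_mp (k : ι) (x : Cube (ModuleCat.{u} A) ι) {T U : Finset ι} (h : U ⊆ T)
    (m : (face k x).vtx T) : ed k x U (mp (face k x) h m) = mp x h (ed k x T m) := by
  simp only [ed, LinearMap.comp_apply, fid_mp, mp_mp]

lemma D_ed (k : ι) (x : Cube (ModuleCat.{u} A) ι) (S : Finset ι) (c : ∀ T, (face k x).vtx T)
    (U : Finset ι) : D x S (fun T => ed k x T (c T)) U = ed k x U (D (face k x) S c U) := by
  simp only [D, map_sum, map_smul, ed_mp]

lemma D_insert (k : ι) (x : Cube (ModuleCat.{u} A) ι) (S : Finset ι) (hk : ∀ s ∈ S, s < k)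
    (c : ∀ T, x.vtx T) (U : Finset ι) (hU : U ⊆ S) :
    D x (insert k S) c U = D x S c U + ed k x U (fres k x c U) := by
  have hkS : k ∉ S := fun h => lt_irrefl _ (hk k h)
  have h1 : insert k S \ U = insert k (S \ U) :=
    Finset.insert_sdiff_of_notMem _ (fun h => hkS (hU h))
  have h2 : U.filter (fun t => k < t) = ∅ :=
    Finset.filter_eq_empty_iff.2 fun t ht => (hk t (hU ht)).asymm
  rw [D, h1, Finset.sum_insert (by simp [hkS]), h2, add_comm]
  simp only [Finset.card_empty, pow_zero, one_smul]
  rfl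

lemma D_insert' (k : ι) (x : Cube (ModuleCat.{u} A) ι) (S : Finset ι) (hk : ∀ s ∈ S, s < k)
    (c : ∀ T, x.vtx T) (U : Finset ι) (hU : U ⊆ S) :
    D x (insert k S) c (insert k U) = - fid k x U (D (face k x) S (fres k x c) U) := by
  have hkS : k ∉ S := fun h => lt_irrefl _ (hk k h)
  have h1 : insert k S \ insert k U = S \ U := by
    ext a; simp only [Finset.mem_sdiff, Finset.mem_insert]
    constructor
    · tauto
    · rintro ⟨h, h'⟩
      exact ⟨Or.inr h, fun h2 => h2.elim (fun e => hkS (e ▸ h)) h'⟩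
  rw [D, h1, D, map_sum, ← Finset.sum_neg_distrib]
  refine Finset.sum_congr rfl fun j hj => ?_
  rw [Finset.mem_sdiff] at hj
  have h2 : (insert k U).filter (fun t => j < t) = insert k (U.filter (fun t => j < t)) := by
    rw [Finset.filter_insert, if_pos (hk j hj.1)]
  rw [h2, Finset.card_insert_of_notMem (fun h => hkS (hU (Finset.mem_filter.1 h).1)), map_smul,
    fid_mp, pow_succ, mul_neg_one, neg_smul]
  congr 2
  exact mp_congr x c (Finset.insert_comm _ _ _) _ _

lemma cases_insert {k : ι} {S U : Finset ι} (hU : U ⊆ insert k S) :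
    U ⊆ S ∨ ∃ V ⊆ S, k ∉ V ∧ U = insert k V := by
  by_cases h : k ∈ U
  · refine Or.inr ⟨U.erase k, ?_, Finset.notMem_erase _ _, (Finset.insert_erase h).symm⟩
    exact Finset.subset_insert_iff.1 hU
  · exact Or.inl ((Finset.subset_insert_iff_of_notMem h).1 hU)

lemma D_D (S : Finset ι) : ∀ (x : Cube (ModuleCat.{u} A) ι) (c : ∀ T, x.vtx T),
    ∀ U ⊆ S, D x S (D x S c) U = 0 := by
  induction S using Finset.induction_on_max with
  | empty => intro x c U hU; simp [D]
  | insert k S hk ih =>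
    intro x c U hU
    rcases cases_insert hU with hU | ⟨V, hV, hkV, rfl⟩
    · rw [D_insert k x S hk _ U hU]
      have h1 : D x S (D x (insert k S) c) U =
          D x S (fun T => D x S c T + ed k x T (fres k x c T)) U := by
        apply D_congr
        intro j hj _
        exact D_insert k x S hk _ _ (Finset.insert_subset hj hU)
      have h2 : fres k x (D x (insert k S) c) U = - D (face k x) S (fres k x c) U :=
        D_insert' k x S hk c U hU
      rw [h1, D_add, D_ed, ih x c U hU, h2, map_neg, zero_add, add_neg_cancel]
    · rw [D_insert' k x S hk _ V hV]
      have h2 : D (face k x) S (fres k x (D x (insert k S) c)) V =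
          D (face k x) S (fun T => - D (face k x) S (fres k x c) T) V := by
        apply D_congr
        intro j hj _
        exact D_insert' k x S hk _ _ (Finset.insert_subset hj hV)
      rw [h2, D_neg, ih _ _ V hV]
      simp

/-- ideal generated by `f s`, `s ∈ U` -/
abbrev idl (f : ι → A) (U : Finset ι) : Ideal A := Ideal.span (f '' (U : Set ι))

/-- regularity in every order on a module -/
def Reg (S : Finset ι) (f : ι → A) (M : Type u) [AddCommGroup M] [Module A M] : Prop :=
  ∀ U ⊆ S, ∀ j ∈ S, j ∉ U → ∀ m : M, f j • m ∈ idl f U • (⊤ : Submodule A M) →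
    m ∈ idl f U • (⊤ : Submodule A M)

/-- weak Koszul cubes -/
structure Good (x : Cube (ModuleCat.{u} A) ι) (S : Finset ι) (f : ι → A) : Prop where
  reg : ∀ T ⊆ S, Reg S f (x.vtx T)
  inj : ∀ T ⊆ S, ∀ j ∈ S, j ∉ T → Function.Injective (mp x (Finset.subset_insert j T))
  ann : ∀ T ⊆ S, ∀ j ∈ S, j ∉ T → ∃ n : ℕ, ∀ m : x.vtx T,
    ∃ m', mp x (Finset.subset_insert j T) m' = f j ^ n • m

lemma Reg.mono {S S' : Finset ι} {f : ι → A} {M : Type u} [AddCommGroup M] [Module A M]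
    (h : Reg S f M) (hS : S' ⊆ S) : Reg S' f M :=
  fun U hU j hj hjU m hm => h U (hU.trans hS) j (hS hj) hjU m hm

lemma Good.mono {x : Cube (ModuleCat.{u} A) ι} {S S' : Finset ι} {f : ι → A}
    (h : Good x S f) (hS : S' ⊆ S) : Good x S' f where
  reg T hT := (h.reg T (hT.trans hS)).mono hS
  inj T hT j hj hjT := h.inj T (hT.trans hS) j (hS hj) hjT
  ann T hT j hj hjT := h.ann T (hT.trans hS) j (hS hj) hjT

lemma Good.face {x : Cube (ModuleCat.{u} A) ι} {S : Finset ι} {k : ι} {f : ι → A}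
    (h : Good x (insert k S) f) (hk : k ∉ S) : Good (face k x) S f where
  reg T hT := (h.reg (insert k T) (Finset.insert_subset_insert k hT)).mono
    (Finset.subset_insert _ _)
  inj T hT j hj hjT := by
    have hj' : j ∉ insert k T := by
      rw [Finset.mem_insert]; rintro (rfl | h) <;> contradiction
    have h1 := h.inj (insert k T) (Finset.insert_subset_insert k hT) j
      (Finset.mem_insert_of_mem hj) hj'
    intro a b hab
    have e : insert j (insert k T) ⊆ insert k (insert j T) := (Finset.insert_comm _ _ _).subset
    have e' : insert k (insert j T) ⊆ insert j (insert k T) := (Finset.insert_comm _ _ _).subset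
    have h2 : mp x e (fid k x _ a) = mp x e (fid k x _ b) := by
      apply h1
      rw [mp_mp, mp_mp]
      exact hab
    have h3 := congrArg (mp x e') h2
    rw [mp_mp, mp_mp, mp_self, mp_self] at h3
    exact h3
  ann T hT j hj hjT := by
    have hj' : j ∉ insert k T := by
      rw [Finset.mem_insert]; rintro (rfl | h) <;> contradiction
    obtain ⟨n, hn⟩ := h.ann (insert k T) (Finset.insert_subset_insert k hT) j
      (Finset.mem_insert_of_mem hj) hj'
    refine ⟨n, fun m => ?_⟩
    obtain ⟨m', hm'⟩ := hn (fid k x _ m)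
    have e' : insert k (insert j T) ⊆ insert j (insert k T) := (Finset.insert_comm _ _ _).subset
    refine ⟨mp x e' m', ?_⟩
    apply fid_inj
    rw [map_smul, ← hm']
    exact mp_mp x _ _ _

/-- quotient functor `M ↦ M / f M` -/
noncomputable def quo (a : A) : ModuleCat.{u} A ⥤ ModuleCat.{u} A where
  obj M := ModuleCat.of A (M ⧸ (Ideal.span {a} • (⊤ : Submodule A M)))
  map {M N} g := ModuleCat.ofHom (Submodule.mapQ _ _ g.hom (by
    rw [← Submodule.map_le_iff_le_comap, Submodule.map_smul'']
    exact Submodule.smul_mono le_rfl le_top))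
  map_id M := by
    ext m
    rfl
  map_comp g h := by
    ext m
    rfl

lemma mem_span_smul_top {M : Type u} [AddCommGroup M] [Module A M] (a : A) (m : M) :
    m ∈ Ideal.span {a} • (⊤ : Submodule A M) ↔ ∃ m', m = a • m' := by
  rw [Submodule.ideal_span_singleton_smul, Submodule.mem_smul_pointwise_iff_exists]
  constructor
  · rintro ⟨b, -, rfl⟩; exact ⟨b, rfl⟩
  · rintro ⟨b, rfl⟩; exact ⟨b, trivial, rfl⟩

/-- quotient cube -/
noncomputable def qc (a : A) (x : Cube (ModuleCat.{u} A) ι) : Cube (ModuleCat.{u} A) ι :=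
  x ⋙ quo a

/-- projection to the quotient cube -/
noncomputable def pr (a : A) (x : Cube (ModuleCat.{u} A) ι) (T : Finset ι) :
    x.vtx T →ₗ[A] (qc a x).vtx T :=
  Submodule.mkQ (Ideal.span {a} • (⊤ : Submodule A (x.vtx T)))

lemma pr_surj (a : A) (x : Cube (ModuleCat.{u} A) ι) (T : Finset ι) :
    Function.Surjective (pr a x T) := Submodule.mkQ_surjective _

lemma pr_ker (a : A) (x : Cube (ModuleCat.{u} A) ι) (T : Finset ι) :
    LinearMap.ker (pr a x T) = Ideal.span {a} • (⊤ : Submodule A (x.vtx T)) :=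
  Submodule.ker_mkQ _

lemma pr_eq_zero (a : A) (x : Cube (ModuleCat.{u} A) ι) (T : Finset ι) (m : x.vtx T) :
    pr a x T m = 0 ↔ ∃ m', m = a • m' := by
  rw [← mem_span_smul_top, ← pr_ker, LinearMap.mem_ker]

lemma pr_mp (a : A) (x : Cube (ModuleCat.{u} A) ι) {T U : Finset ι} (h : U ⊆ T)
    (m : x.vtx T) : mp (qc a x) h (pr a x T m) = pr a x U (mp x h m) := rfl

lemma D_pr (a : A) (x : Cube (ModuleCat.{u} A) ι) (S : Finset ι) (c : ∀ T, x.vtx T)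
    (U : Finset ι) : D (qc a x) S (fun T => pr a x T (c T)) U = pr a x U (D x S c U) := by
  simp only [D, map_sum, map_smul, pr_mp]

lemma Reg.nzd {S : Finset ι} {f : ι → A} {M : Type u} [AddCommGroup M] [Module A M]
    (h : Reg S f M) {k : ι} (hk : k ∈ S) (m : M) (hm : f k • m = 0) : m = 0 := by
  have := h ∅ (Finset.empty_subset _) k hk (Finset.notMem_empty _) m (by simp [hm])
  simpa [idl] using this

lemma Reg.nzd2 {S : Finset ι} {f : ι → A} {M : Type u} [AddCommGroup M] [Module A M]
    (h : Reg S f M) {k j : ι} (hk : k ∈ S) (hj : j ∈ S) (hjk : j ≠ k) (n : ℕ) :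
    ∀ (m m' : M), f j ^ n • m = f k • m' → ∃ m'', m = f k • m'' := by
  induction n with
  | zero => intro m m' hm; exact ⟨m', by simpa using hm⟩
  | succ n ih =>
    intro m m' hm
    have h1 : f j • (f j ^ n • m) = f k • m' := by rw [← hm, smul_smul, pow_succ']
    have h2 := h {k} (by simpa using hk) j hj (by simpa using hjk) (f j ^ n • m) (by
      simp only [idl, Finset.coe_singleton, Set.image_singleton]
      rw [mem_span_smul_top]
      exact ⟨m', h1⟩)
    simp only [idl, Finset.coe_singleton, Set.image_singleton] at h2
    rw [mem_span_smul_top] at h2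
    obtain ⟨m'', h2⟩ := h2
    exact ih m m'' h2

lemma Good.qc {x : Cube (ModuleCat.{u} A) ι} {S S' : Finset ι} {f : ι → A} {k : ι}
    (h : Good x S' f) (hreg : ∀ T ⊆ S', Reg S f (x.vtx T)) (hS : insert k S' ⊆ S) (hk : k ∉ S') :
    Good (qc (f k) x) S' f where
  reg T hT U hU j hj hjU m hm := by
    obtain ⟨m, rfl⟩ := pr_surj _ _ _ m
    have key : ∀ m : x.vtx T,
        pr (f k) x T m ∈ idl f U • (⊤ : Submodule A ((KoszulAux.qc (f k) x).vtx T)) ↔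
        m ∈ idl f (insert k U) • (⊤ : Submodule A (x.vtx T)) := by
      intro m
      have h1 : idl f U • (⊤ : Submodule A ((KoszulAux.qc (f k) x).vtx T)) =
          Submodule.map (pr (f k) x T) (idl f U • ⊤) := by
        rw [Submodule.map_smul'', Submodule.map_top, LinearMap.range_eq_top.2 (pr_surj _ _ _)]
      rw [h1, ← Submodule.mem_comap, Submodule.comap_map_eq, pr_ker, idl, idl,
        Finset.coe_insert, Set.image_insert_eq, Ideal.span_insert, Submodule.sup_smul, sup_comm]
    rw [key]
    rw [← map_smul, key] at hm
    refine hreg T hT (insert k U) ((Finset.insert_subset_insert _ hU).trans hS) j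
      (hS (Finset.mem_insert_of_mem hj)) ?_ m hm
    rw [Finset.mem_insert]; rintro (rfl | h) <;> contradiction
  inj T hT j hj hjT := by
    rw [injective_iff_map_eq_zero]
    intro m hm
    obtain ⟨m, rfl⟩ := pr_surj _ _ _ m
    rw [pr_mp, pr_eq_zero] at hm
    obtain ⟨m', hm'⟩ := hm
    obtain ⟨n, hn⟩ := h.ann T hT j hj hjT
    obtain ⟨m'', hm''⟩ := hn m'
    have e : f j ^ n • m = f k • m'' := by
      apply h.inj T hT j hj hjT
      rw [map_smul, map_smul, hm', hm'', smul_comm]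
    rw [pr_eq_zero]
    exact (hreg (insert j T) (Finset.insert_subset hj hT)).nzd2
      (hS (Finset.mem_insert_self _ _))
      (hS (Finset.mem_insert_of_mem hj)) (by rintro rfl; contradiction) n _ _ e
  ann T hT j hj hjT := by
    obtain ⟨n, hn⟩ := h.ann T hT j hj hjT
    refine ⟨n, fun m => ?_⟩
    obtain ⟨m, rfl⟩ := pr_surj _ _ _ m
    obtain ⟨m', hm'⟩ := hn m
    exact ⟨pr _ _ _ m', by rw [pr_mp, hm', map_smul]⟩

/-- exactness in positive degrees -/
def Ex (x : Cube (ModuleCat.{u} A) ι) (S : Finset ι) : Prop :=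
  ∀ (n : ℕ) (c : ∀ T, x.vtx T), (∀ U ⊆ S, U.card = n → D x S c U = 0) →
    ∃ b : ∀ T, x.vtx T, ∀ T ⊆ S, T.card = n + 1 → c T = D x S b T

/-- `f k` is a nonzerodivisor on `H₀` -/
lemma h0_nzd {x : Cube (ModuleCat.{u} A) ι} {S : Finset ι} (a : A)
    (hex : Ex (qc a x) S) (ha : ∀ m : x.vtx ∅, a • m = 0 → m = 0)
    (z : x.vtx ∅) (c : ∀ T, x.vtx T) (hz : a • z = D x S c ∅) :
    ∃ b : ∀ T, x.vtx T, z = D x S b ∅ := by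
  obtain ⟨b, hb⟩ := hex 0 (fun T => pr a x T (c T)) (by
    intro U hU hU0
    rw [Finset.card_eq_zero] at hU0
    subst hU0
    rw [D_pr, ← hz, pr_eq_zero]
    exact ⟨z, rfl⟩)
  choose b' hb' using fun T => pr_surj a x T (b T)
  have hbb : b = fun T => pr a x T (b' T) := funext fun T => (hb' T).symm
  rw [hbb] at hb
  have : ∀ T : Finset ι, ∃ u : x.vtx T, T ⊆ S → T.card = 1 → c T = D x S b' T + a • u := by
    intro T
    by_cases hT : T ⊆ S ∧ T.card = 1
    · have h1 := hb T hT.1 hT.2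
      rw [D_pr, ← sub_eq_zero, ← map_sub, pr_eq_zero] at h1
      obtain ⟨u, hu⟩ := h1
      exact ⟨u, fun _ _ => by rw [← hu]; abel⟩
    · exact ⟨0, fun h1 h2 => (hT ⟨h1, h2⟩).elim⟩
  choose v hv using this
  refine ⟨v, ?_⟩
  have h2 : D x S c ∅ = D x S (fun T => D x S b' T + a • v T) ∅ := by
    apply D_congr
    intro j hj _
    exact hv _ (by simpa using hj) (by simp)
  rw [D_add, D_D S x b' ∅ (Finset.empty_subset _), zero_add, D_smul, ← hz] at h2
  rw [← sub_eq_zero]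
  apply ha
  rw [smul_sub, h2, sub_self]

lemma h0_nzd_pow {x : Cube (ModuleCat.{u} A) ι} {S : Finset ι} (a : A)
    (hex : Ex (qc a x) S) (ha : ∀ m : x.vtx ∅, a • m = 0 → m = 0) (n : ℕ) :
    ∀ (z : x.vtx ∅) (c : ∀ T, x.vtx T) (_ : a ^ n • z = D x S c ∅),
    ∃ b : ∀ T, x.vtx T, z = D x S b ∅ := by
  induction n with
  | zero => intro z c h; exact ⟨c, by simpa using h⟩
  | succ n ih =>
    intro z c h
    obtain ⟨b, hb⟩ := h0_nzd a hex ha (a ^ n • z) c (by rw [← h, smul_smul, pow_succ'])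
    exact ih z b hb

lemma good_ex (f : ι → A) (S : Finset ι) :
    ∀ x : Cube (ModuleCat.{u} A) ι, Good x S f → Ex x S := by
  induction S using Finset.induction_on_max with
  | empty =>
    intro x hx n c hc
    refine ⟨fun _ => 0, fun T hT hn => ?_⟩
    rw [Finset.subset_empty] at hT
    subst hT
    simp at hn
  | insert k S hk ih =>
    intro x hx n c hc
    have hkS : k ∉ S := fun h => lt_irrefl _ (hk k h)
    have hkk : k ∈ insert k S := Finset.mem_insert_self _ _
    have gx : Good x S f := hx.mono (Finset.subset_insert _ _)
    have gy : Good (face k x) S f := hx.face hkS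
    have ry : ∀ T ⊆ S, Reg (insert k S) f ((face k x).vtx T) := fun T hT =>
      hx.reg (insert k T) (Finset.insert_subset_insert k hT)
    have gq : Good (qc (f k) (face k x)) S f := gy.qc ry subset_rfl hkS
    have claim : ∃ b' : ∀ T, (face k x).vtx T, ∀ T ⊆ S, T.card = n →
        fres k x c T = D (face k x) S b' T := by
      cases n with
      | succ n =>
        refine ih _ gy n (fres k x c) fun U hU hn => ?_
        have h1 := hc (insert k U) (Finset.insert_subset_insert k hU)
          (by rw [Finset.card_insert_of_notMem (fun h => hkS (hU h)), hn])
        rw [D_insert' k x S hk c U hU, neg_eq_zero] at h1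
        exact h1
      | zero =>
        have h1 := hc ∅ (Finset.empty_subset _) rfl
        rw [D_insert k x S hk c ∅ (Finset.empty_subset _)] at h1
        -- uniform exponent
        have hN : ∃ N : ℕ, ∀ j ∈ S, ∀ m : x.vtx {j}, ∃ m' : (face k x).vtx {j},
            ed k x {j} m' = f k ^ N • m := by
          have : ∀ j : ι, ∃ n : ℕ, j ∈ S → ∀ m : x.vtx {j}, ∃ m' : (face k x).vtx {j},
            ed k x {j} m' = f k ^ n • m := by
            intro j
            by_cases hj : j ∈ S
            · obtain ⟨n, hn⟩ := hx.ann {j} (by simp [hj]) k hkk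
                (by simp only [Finset.mem_singleton]; rintro rfl; contradiction)
              exact ⟨n, fun _ m => hn m⟩
            · exact ⟨0, fun h => (hj h).elim⟩
          choose e he using this
          refine ⟨∑ j ∈ S, e j, fun j hj m => ?_⟩
          have hle : e j ≤ ∑ j ∈ S, e j := Finset.single_le_sum (fun _ _ => Nat.zero_le _) hj
          obtain ⟨m', hm'⟩ := he j hj (f k ^ (∑ j ∈ S, e j - e j) • m)
          refine ⟨m', ?_⟩
          rw [hm', smul_smul, ← pow_add]
          congr 2
          omega
        obtain ⟨N, hN⟩ := hN
        have : ∀ T : Finset ι, ∃ u : (face k x).vtx T, T ⊆ S → T.card = 1 →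
            ed k x T u = f k ^ N • (- c T) := by
          intro T
          by_cases hT : T ⊆ S ∧ T.card = 1
          · obtain ⟨h2, h3⟩ := hT
            obtain ⟨j, rfl⟩ := Finset.card_eq_one.1 h3
            obtain ⟨m', hm'⟩ := hN j (by simpa using h2) (- c {j})
            exact ⟨m', fun _ _ => hm'⟩
          · exact ⟨0, fun h1 h2 => (hT ⟨h1, h2⟩).elim⟩
        choose v hv using this
        have h2 : f k ^ N • fres k x c ∅ = D (face k x) S v ∅ := by
          have hinj : Function.Injective (ed k x ∅) :=
            hx.inj ∅ (Finset.empty_subset _) k hkk (Finset.notMem_empty _)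
          apply hinj
          rw [map_smul, ← D_ed]
          have h3 : D x S (fun T => ed k x T (v T)) ∅ =
              D x S (fun T => f k ^ N • (- c T)) ∅ := by
            apply D_congr
            intro j hj _
            exact hv _ (by simpa using hj) (by simp)
          rw [h3, D_smul, D_neg, ← eq_neg_of_add_eq_zero_right h1]
        obtain ⟨b, hb⟩ := h0_nzd_pow (f k) (ih _ gq)
          (fun m hm => (ry ∅ (Finset.empty_subset _)).nzd hkk m hm) N _ _ h2
        refine ⟨b, fun T hT hn => ?_⟩
        rw [Finset.card_eq_zero] at hn
        subst hn
        exact hb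
    obtain ⟨b', hb'⟩ := claim
    obtain ⟨b0, hb0⟩ := ih x gx n (fun T => c T + ed k x T (b' T)) (by
      intro U hU hn
      have h1 := hc U (hU.trans (Finset.subset_insert _ _)) hn
      rw [D_insert k x S hk c U hU] at h1
      rw [D_add, D_ed, ← hb' U hU hn, h1])
    let b : ∀ T, x.vtx T := fun T => if k ∈ T then
      - mp x (Finset.insert_erase_subset k T) (fid k x _ (b' (T.erase k))) else b0 T
    have hbk : ∀ T : Finset ι, k ∉ T → fres k x b T = - b' T := by
      intro T hT
      apply fid_inj
      have e : ∀ (V : Finset ι) (h : insert k T ⊆ insert k V), V = T →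
        mp x h (fid k x V (b' V)) = fid k x T (b' T) := by
        rintro V h rfl
        exact mp_self x _ _
      have h1 : b (insert k T) = - mp x (Finset.insert_erase_subset k (insert k T))
        (fid k x _ (b' ((insert k T).erase k))) := if_pos (Finset.mem_insert_self _ _)
      rw [e _ _ (Finset.erase_insert hT)] at h1
      rw [map_neg]
      exact h1
    have hb0' : ∀ T : Finset ι, k ∉ T → b T = b0 T := fun T hT => if_neg hT
    refine ⟨b, fun T hT hn => ?_⟩
    rcases cases_insert hT with hT | ⟨V, hV, hkV, rfl⟩
    · rw [D_insert k x S hk b T hT, hbk T (fun h => hkS (hT h))]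
      have h3 : D x S b T = D x S b0 T := by
        apply D_congr
        intro j hj _
        exact hb0' _ (fun h => hkS (Finset.insert_subset hj hT h))
      rw [h3, ← hb0 T hT hn, map_neg]
      abel
    · rw [D_insert' k x S hk b V hV]
      have h3 : D (face k x) S (fres k x b) V = D (face k x) S (fun T => - b' T) V := by
        apply D_congr
        intro j hj _
        exact hbk _ (fun h => hkS (Finset.insert_subset hj hV h))
      rw [Finset.card_insert_of_notMem hkV] at hn
      rw [h3, D_neg, ← hb' V hV (by omega), map_neg, neg_neg]
      rfl


/-- extension by zero of a chain of the total complex to a family -/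
noncomputable def ex0 (x : Cube (ModuleCat.{u} A) ι) {S : Finset ι} {n : ℕ}
    (c : DirectSum {T : Finset ι // T ∈ Finset.powersetCard n S} (fun T => x.vtx T.1)) :
    ∀ T, x.vtx T := fun T => if h : T ∈ Finset.powersetCard n S then c ⟨T, h⟩ else 0

lemma lof_mp (x : Cube (ModuleCat.{u} A) ι) {S : Finset ι} {n : ℕ} {T V U : Finset ι}
    (hV : V ∈ Finset.powersetCard n S) (hU : U ∈ Finset.powersetCard n S) (h : V ⊆ T)
    (m : x.vtx T) :
    (DirectSum.lof A {T : Finset ι // T ∈ Finset.powersetCard n S} (fun T => x.vtx T.1) ⟨V, hV⟩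
      (mp x h m)) ⟨U, hU⟩ = if e : V = U then mp x (e ▸ h) m else 0 := by
  by_cases e : V = U
  · subst e
    rw [dif_pos rfl]
    exact DirectSum.lof_apply A _ _
  · rw [dif_neg e, DirectSum.lof_eq_of]
    exact DirectSum.of_eq_of_ne _ _ _ (fun h => e (congrArg Subtype.val h).symm)

lemma ex0_lof (x : Cube (ModuleCat.{u} A) ι) {S : Finset ι} {n : ℕ} {T V : Finset ι}
    (hT : T ∈ Finset.powersetCard n S) (m : x.vtx T) :
    ex0 x (DirectSum.lof A {T : Finset ι // T ∈ Finset.powersetCard n S} (fun T => x.vtx T.1)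
      ⟨T, hT⟩ m) V = if e : T = V then mp x e.ge m else 0 := by
  unfold ex0
  by_cases hV : V ∈ Finset.powersetCard n S
  · rw [dif_pos hV]
    have := lof_mp x hT hV (subset_refl T) m
    rw [mp_self] at this
    exact this
  · rw [dif_neg hV, dif_neg]
    rintro rfl; contradiction

lemma ex0_add (x : Cube (ModuleCat.{u} A) ι) {S : Finset ι} {n : ℕ}
    (c c' : DirectSum {T : Finset ι // T ∈ Finset.powersetCard n S} (fun T => x.vtx T.1)) :
    ex0 x (c + c') = fun T => ex0 x c T + ex0 x c' T := by
  funext T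
  unfold ex0
  split_ifs <;> simp

lemma ex0_zero (x : Cube (ModuleCat.{u} A) ι) {S : Finset ι} {n : ℕ} :
    ex0 x (0 : DirectSum {T : Finset ι // T ∈ Finset.powersetCard n S} (fun T => x.vtx T.1)) =
      fun _ => 0 := by
  funext T
  unfold ex0
  split_ifs <;> simp

lemma tot_lof (x : Cube (ModuleCat.{u} A) ι) (S : Finset ι) (n : ℕ) {T U : Finset ι}
    (hT : T ∈ Finset.powersetCard (n+1) S) (hU : U ∈ Finset.powersetCard n S) (m : x.vtx T) :
    totDmod x S n (DirectSum.lof A {T : Finset ι // T ∈ Finset.powersetCard (n+1) S}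
      (fun T => x.vtx T.1) ⟨T, hT⟩ m) ⟨U, hU⟩ =
    ∑ j ∈ T.attach, ((-1 : A) ^ (T.filter (fun t => j.1 < t)).card) •
      (if e : T.erase j.1 = U then mp x (e ▸ Finset.erase_subset j.1 T) m else 0) := by
  unfold totDmod
  rw [DirectSum.toModule_lof, LinearMap.sum_apply, DFinsupp.finsetSum_apply]
  refine Finset.sum_congr rfl fun j hj => ?_
  rw [LinearMap.smul_apply, DirectSum.smul_apply]
  congr 1
  exact lof_mp x _ _ (Finset.erase_subset j.1 T) m

lemma tot_lof_eq (x : Cube (ModuleCat.{u} A) ι) (S : Finset ι) (n : ℕ) {T U : Finset ι}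
    (hT : T ∈ Finset.powersetCard (n+1) S) (hU : U ∈ Finset.powersetCard n S) (m : x.vtx T) :
    totDmod x S n (DirectSum.lof A {T : Finset ι // T ∈ Finset.powersetCard (n+1) S}
      (fun T => x.vtx T.1) ⟨T, hT⟩ m) ⟨U, hU⟩ =
    D x S (ex0 x (DirectSum.lof A {T : Finset ι // T ∈ Finset.powersetCard (n+1) S}
      (fun T => x.vtx T.1) ⟨T, hT⟩ m)) U := by
  rw [tot_lof, funext fun V => ex0_lof x (V := V) hT m]
  unfold D
  beta_reduce
  by_cases H : ∃ j, j ∉ U ∧ T = insert j U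
  · obtain ⟨k, hk, rfl⟩ := H
    have hkS : k ∈ S := (Finset.mem_powersetCard.1 hT).1 (Finset.mem_insert_self _ _)
    rw [Finset.sum_eq_single ⟨k, Finset.mem_insert_self _ _⟩,
      Finset.sum_eq_single k]
    · rw [dif_pos (Finset.erase_insert hk), dif_pos rfl, mp_mp,
        Finset.filter_insert, if_neg (lt_irrefl k)]
    · intro j hj hjk
      rw [Finset.mem_sdiff] at hj
      rw [dif_neg, map_zero, smul_zero]
      intro e
      have : j ∈ insert k U := e ▸ Finset.mem_insert_self j U
      rcases Finset.mem_insert.1 this with h | h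
      · exact hjk h
      · exact hj.2 h
    · intro h
      exact (h (Finset.mem_sdiff.2 ⟨hkS, hk⟩)).elim
    · intro j _ hjk
      rw [dif_neg, smul_zero]
      intro e
      have h1 : k ∈ (insert k U).erase j.1 :=
        Finset.mem_erase.2 ⟨fun h => hjk (Subtype.ext h.symm), Finset.mem_insert_self _ _⟩
      exact hk (e ▸ h1)
    · intro h
      exact (h (Finset.mem_attach _ _)).elim
  · rw [Finset.sum_eq_zero, Finset.sum_eq_zero]
    · intro j hj
      rw [Finset.mem_sdiff] at hj
      rw [dif_neg (fun e => H ⟨j, hj.2, e⟩), map_zero, smul_zero]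
    · intro j _
      rw [dif_neg, smul_zero]
      rintro rfl
      exact H ⟨j.1, Finset.notMem_erase _ _, (Finset.insert_erase j.2).symm⟩

lemma tot_apply (x : Cube (ModuleCat.{u} A) ι) (S : Finset ι) (n : ℕ)
    (c : DirectSum {T : Finset ι // T ∈ Finset.powersetCard (n+1) S} (fun T => x.vtx T.1))
    (U : Finset ι) (hU : U ∈ Finset.powersetCard n S) :
    totDmod x S n c ⟨U, hU⟩ = D x S (ex0 x c) U := by
  induction c using DirectSum.induction_on with
  | zero => rw [map_zero, ex0_zero]; simp [D]
  | add c c' h h' => rw [map_add, DirectSum.add_apply, h, h', ex0_add, D_add]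
  | of T m =>
    exact tot_lof_eq x S n T.2 hU m

lemma tot_exact (x : Cube (ModuleCat.{u} A) ι) (S : Finset ι) (hex : Ex x S) (n : ℕ) :
    LinearMap.ker (totDmod x S n) = LinearMap.range (totDmod x S (n+1)) := by
  apply le_antisymm
  · intro c hc
    rw [LinearMap.mem_ker] at hc
    obtain ⟨b, hb⟩ := hex n (ex0 x c) (by
      intro U hU hn
      have := tot_apply x S n c U (Finset.mem_powersetCard.2 ⟨hU, hn⟩)
      rw [hc] at this
      exact this.symm)
    let b' : DirectSum {T : Finset ι // T ∈ Finset.powersetCard (n+1+1) S}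
      (fun T => x.vtx T.1) := DFinsupp.equivFunOnFintype.symm (fun T => b T.1)
    have hb' : ∀ T ∈ Finset.powersetCard (n+1+1) S, ex0 x b' T = b T := by
      intro T hT
      unfold ex0
      rw [dif_pos hT]
      rfl
    refine ⟨b', ?_⟩
    refine DFinsupp.ext fun U => ?_
    obtain ⟨U, hU⟩ := U
    obtain ⟨h1, h2⟩ := Finset.mem_powersetCard.1 hU
    refine (tot_apply x S (n+1) b' U hU).trans ?_
    have h3 : D x S (ex0 x b') U = D x S b U := by
      apply D_congr
      intro j hj hjU
      exact hb' _ (Finset.mem_powersetCard.2 ⟨Finset.insert_subset hj h1, by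
        rw [Finset.card_insert_of_notMem hjU, h2]⟩)
    rw [h3, ← hb U h1 h2]
    unfold ex0
    rw [dif_pos hU]
  · rintro _ ⟨b, rfl⟩
    rw [LinearMap.mem_ker]
    refine DFinsupp.ext fun U => ?_
    obtain ⟨U, hU⟩ := U
    obtain ⟨h1, h2⟩ := Finset.mem_powersetCard.1 hU
    refine (tot_apply x S n _ U hU).trans ?_
    have h3 : D x S (ex0 x (totDmod x S (n+1) b)) U = D x S (D x S (ex0 x b)) U := by
      apply D_congr
      intro j hj hjU
      have h4 : insert j U ∈ Finset.powersetCard (n+1) S :=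
        Finset.mem_powersetCard.2 ⟨Finset.insert_subset hj h1, by
          rw [Finset.card_insert_of_notMem hjU, h2]⟩
      rw [← tot_apply x S (n+1) b _ h4]
      exact dif_pos h4
    rw [h3, D_D S x _ U h1]
    rfl

lemma reg_ring {S : Finset ι} {f : ι → A} (hf : IsFamilyASeq S f) (U : Finset ι) (hU : U ⊆ S)
    (j : ι) (hj : j ∈ S) (hjU : j ∉ U) (a : A) (h : f j * a ∈ idl f U) : a ∈ idl f U := by
  have hr := (hf (U.toList ++ j :: (S \ insert j U).toList) (by
    rw [List.nodup_append, List.nodup_cons]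
    refine ⟨Finset.nodup_toList _, ⟨by simp, Finset.nodup_toList _⟩, ?_⟩
    intro a ha b hb
    rw [Finset.mem_toList] at ha
    rw [List.mem_cons, Finset.mem_toList, Finset.mem_sdiff, Finset.mem_insert] at hb
    rintro rfl
    rcases hb with rfl | hb
    · exact hjU ha
    · exact hb.2 (Or.inr ha)) (by
    ext a
    simp only [List.toFinset_append, List.toFinset_cons, Finset.toList_toFinset,
      Finset.mem_union, Finset.mem_insert, Finset.mem_sdiff]
    constructor
    · rintro (h | rfl | h)
      · exact hU h
      · exact hj
      · exact h.1
    · tauto)).2 ⟨U.card, by simp⟩ a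
  have h1 : {y | y ∈ (List.map f (U.toList ++ j :: (S \ insert j U).toList)).take U.card} =
      f '' (U : Set ι) := by
    ext y
    rw [List.map_append, List.take_left' (by simp)]
    simp
  simp only [h1] at hr
  apply hr
  have h2 : (List.map f (U.toList ++ j :: (S \ insert j U).toList)).get ⟨U.card, by simp⟩ =
      f j := by
    simp [List.getElem_append_right]
  rw [h2]
  exact h

lemma mem_smul_top_iff {M : Type u} [AddCommGroup M] [Module A M] {κ : Type u}
    (b : Module.Basis κ A M) (I : Ideal A) (m : M) :
    m ∈ I • (⊤ : Submodule A M) ↔ ∀ i, b.repr m i ∈ I := by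
  constructor
  · intro h i
    have h1 := Submodule.mem_map_of_mem (f := b.coord i) h
    rw [Submodule.map_smul''] at h1
    exact Ideal.mul_le_left (I := I) (J := Submodule.map (b.coord i) ⊤) h1
  · intro h
    rw [← b.linearCombination_repr m, Finsupp.linearCombination_apply]
    exact Submodule.sum_mem _ fun i _ => Submodule.smul_mem_smul (h i) trivial

lemma reg_free {S : Finset ι} {f : ι → A} (hf : IsFamilyASeq S f) (M : Type u)
    [AddCommGroup M] [Module A M] [Module.Free A M] : Reg S f M := by
  intro U hU j hj hjU m hm
  rw [mem_smul_top_iff (Module.Free.chooseBasis A M)] at hm ⊢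
  intro i
  apply reg_ring hf U hU j hj hjU
  have := hm i
  rwa [map_smul, Finsupp.smul_apply, smul_eq_mul] at this

lemma good_of_koszul (S : Finset ι) (f : ι → A)
    (hf : IsFamilyASeq S f) (x : Cube (ModuleCat.{u} A) ι) (hx : IsKoszulCube x S f)
    (hfree : ∀ T ⊆ S, Module.Free A (x.vtx T)) : Good x S f := by
  have key : ∀ T ⊆ S, ∀ j ∈ S, j ∉ T → ∀ V, ∀ e : V = T, ∀ h : V ⊆ insert j T,
      (Function.Injective (mp x h) ∧ 
        ∃ n : ℕ, ∀ m : x.vtx V ⧸ LinearMap.range (mp x h), f j ^ n • m = 0) →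
      Function.Injective (mp x (Finset.subset_insert j T)) ∧ ∃ n : ℕ, ∀ m : x.vtx T,
        ∃ m', mp x (Finset.subset_insert j T) m' = f j ^ n • m := by
    rintro T hT j hj hjT V rfl h ⟨h1, n, hn⟩
    refine ⟨h1, n, fun m => ?_⟩
    have := hn (Submodule.Quotient.mk m)
    rw [← Submodule.Quotient.mk_smul, Submodule.Quotient.mk_eq_zero] at this
    exact this
  have key2 : ∀ T ⊆ S, ∀ j ∈ S, j ∉ T →
      Function.Injective (mp x (Finset.subset_insert j T)) ∧ ∃ n : ℕ, ∀ m : x.vtx T,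
        ∃ m', mp x (Finset.subset_insert j T) m' = f j ^ n • m := by
    intro T hT j hj hjT
    obtain ⟨h1, -, h2⟩ := hx.2 (insert j T) (Finset.insert_subset hj hT) j
      (Finset.mem_insert_self _ _)
    exact key T hT j hj hjT _ (Finset.erase_insert hjT) (Finset.erase_subset _ _) ⟨h1, h2⟩
  exact ⟨fun T hT => haveI := hfree T hT; reg_free hf _,
    fun T hT j hj hjT => (key2 T hT j hj hjT).1, fun T hT j hj hjT => (key2 T hT j hj hjT).2⟩

end KoszulAux

/-- For any non-degenerate free Koszul `S`-cube `x` over a commutative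
noetherian ring `A` associated with an `A`-sequence `{f s}_{s ∈ S}`, the total complex
`Tot x` is `0`-spherical: `H_k(Tot x) = 0` for all `k ≠ 0`, i.e. the total complex is exact
in every positive degree. -/
theorem tot_of_nondegenerate_free_koszul_cube_zero_spherical {A : Type u} [CommRing A]
    [IsNoetherianRing A] {ι : Type w} [LinearOrder ι] (S : Finset ι) (f : ι → A)
    (hf : IsFamilyASeq S f) (x : Cube (ModuleCat.{u} A) ι) (hx : IsKoszulCube x S f)
    (hfree : ∀ T ⊆ S, Module.Free A (x.vtx T))
    (hnd : ∀ T ⊆ S, ∀ k ∈ T, ¬ IsIso (x.bd T k)) :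
    ∀ n : ℕ, LinearMap.ker (totDmod x S n) = LinearMap.range (totDmod x S (n+1)) := by
  exact KoszulAux.tot_exact x S (KoszulAux.good_ex f S x
    (KoszulAux.good_of_koszul S f hf x hx hfree))
end

section
/- Every Koszul cube over a commutative noetherian ring A (an S-cube of finitely generated projective A-modules associated with an A-sequence {f_s}_{s∈S}) is admissible. -/
open CategoryTheory CategoryTheory.Limits Opposite

attribute [local instance] CategoryTheory.Abelian.hasFiniteBiproducts

set_option linter.unusedSectionVars false

universe w v u

namespace Cube

variable {𝒜 : Type u} [Category.{v} 𝒜] {ι : Type w} [DecidableEq ι]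

/-- The `k`-direction `0`-th homology `H⁰ₖ(x)` of a cube in an abelian category, an
`(S ∖ {k})`-cube: its vertex at `T` is the cokernel of the boundary morphism
`d^k_{T ∪ {k}} : x_{T ∪ {k}} ⟶ x_{(T ∪ {k}) ∖ {k}}`. -/
noncomputable def H0 [Abelian 𝒜] (x : Cube 𝒜 ι) (k : ι) : Cube 𝒜 ι where
  obj T := cokernel (x.bd (insert k T.unop) k)
  map {T U} f :=
    cokernel.map _ _
      (x.mapLE (Finset.insert_subset_insert k (leOfHom f.unop)))
      (x.mapLE (Finset.erase_subset_erase k (Finset.insert_subset_insert k (leOfHom f.unop))))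
      (by rw [bd, bd, mapLE_comp, mapLE_comp])
  map_id T := by
    apply coequalizer.hom_ext
    simp [cokernel.map]
    rw [mapLE_refl]
    simp
  map_comp {T U V} f g := by
    apply coequalizer.hom_ext
    simp [cokernel.map]
    rw [← Category.assoc, mapLE_comp]

/-- Admissibility of an `S`-cube `x` in an abelian category, by recursion on `#S`:
`x` is admissible if all its boundary morphisms `d^k_T` (`k ∈ T ⊆ S`) are monomorphisms and
for every `k ∈ S` the `(S ∖ {k})`-cube `H⁰ₖ(x)` is admissible.  (For `S = ∅` the conditions
are vacuous, and for `#S = 1` this says exactly that the boundary morphism of `x` is a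
monomorphism.) -/
def Admissible [Abelian 𝒜] (x : Cube 𝒜 ι) (S : Finset ι) : Prop :=
  (∀ T ⊆ S, ∀ k ∈ T, Mono (x.bd T k)) ∧
  ∀ k, (hk : k ∈ S) → Admissible (x.H0 k) (S.erase k)
termination_by S.card
decreasing_by exact Finset.card_erase_lt_of_mem hk

/-- Iterated `0`-th homology:
`H0s x [i₁, …, i_r] = H⁰_{i₁}(H⁰_{i₂}(⋯(H⁰_{i_r}(x))⋯))`. -/
noncomputable def H0s [Abelian 𝒜] (x : Cube 𝒜 ι) : List ι → Cube 𝒜 ι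
  | [] => x
  | k :: ks => (x.H0s ks).H0 k

end Cube

open RingTheory.Sequence in
/-- `f` is weakly regular on `M` for every enumeration of `S`. -/
def RegF {A : Type u} [CommRing A] {ι : Type w} [DecidableEq ι] (f : ι → A) (S : Finset ι)
    (M : Type v) [AddCommGroup M] [Module A M] : Prop :=
  ∀ l : List ι, l.Nodup → l.toFinset = S → IsWeaklyRegular M (l.map f)

section alg

variable {A : Type u} [CommRing A] {ι : Type w} [DecidableEq ι] {f : ι → A}

lemma RegF.cons {S : Finset ι} {M : Type v} [AddCommGroup M] [Module A M] {s : ι} (hs : s ∉ S)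
    (h : RegF f (insert s S) M) :
    IsSMulRegular M (f s) ∧ RegF f S (QuotSMulTop (f s) M) := by
  have key : ∀ l : List ι, l.Nodup → l.toFinset = S →
      IsSMulRegular M (f s) ∧
        RingTheory.Sequence.IsWeaklyRegular (QuotSMulTop (f s) M) (l.map f) := by
    intro l hl hS
    have hsl : s ∉ l := by
      intro h; apply hs; rw [← hS]; simpa using h
    have := h (s :: l) (List.nodup_cons.2 ⟨hsl, hl⟩) (by simp [hS])
    simpa using this
  exact ⟨(key S.toList S.nodup_toList (by simp)).1, fun l hl hS => (key l hl hS).2⟩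

lemma mem_smul_top' {M : Type v} [AddCommGroup M] [Module A M] (a : A) (m : M) :
    (Submodule.Quotient.mk m : QuotSMulTop a M) = 0 ↔ ∃ m', a • m' = m := by
  rw [Submodule.Quotient.mk_eq_zero, Submodule.mem_smul_pointwise_iff_exists]
  simp

lemma pow_reg {N : Type v} [AddCommGroup N] [Module A N] {a b : A} (hb : IsSMulRegular N b)
    (ha : IsSMulRegular (QuotSMulTop b N) a) (n : ℕ) :
    ∀ p y : N, a • p = b ^ n • y → ∃ p', p = b ^ n • p' := by
  induction n with
  | zero => intro p y _; exact ⟨p, by simp⟩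
  | succ n ih =>
    intro p y h
    have h0 : (Submodule.Quotient.mk p : QuotSMulTop b N) = 0 := by
      apply ha
      show a • (Submodule.Quotient.mk p : QuotSMulTop b N) = a • (0 : QuotSMulTop b N)
      rw [smul_zero]
      show a • (Submodule.Quotient.mk p : QuotSMulTop b N) = 0
      rw [← Submodule.Quotient.mk_smul, mem_smul_top']
      exact ⟨b ^ n • y, by rw [h, smul_smul, pow_succ']⟩
    obtain ⟨p', rfl⟩ := (mem_smul_top' _ _).1 h0
    obtain ⟨p'', rfl⟩ := ih p' y (by
      apply hb
      show b • a • p' = b • b ^ n • y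
      rw [smul_comm, h, smul_smul, pow_succ'])
    exact ⟨p'', by rw [smul_smul, pow_succ']⟩

lemma main_list (k : ι) (n : ℕ) (l : List ι) : ∀ {M N Q : Type v} [AddCommGroup M] [Module A M]
    [AddCommGroup N] [Module A N] [AddCommGroup Q] [Module A Q] (φ : N →ₗ[A] M) (ψ : M →ₗ[A] Q),
    Function.Injective φ → Function.Surjective ψ → Function.Exact φ ψ →
    (∀ q : Q, f k ^ n • q = 0) → l.Nodup → k ∉ l →
    RegF f (insert k l.toFinset) M → RegF f (insert k l.toFinset) N →
    RingTheory.Sequence.IsWeaklyRegular Q (l.map f) := by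
  induction l with
  | nil => intros; simp
  | cons s t ih =>
    intro M N Q _ _ _ _ _ _ φ ψ hφ hψ hex hq hl hk hM hN
    have hst : s ∉ t := (List.nodup_cons.1 hl).1
    have hks : k ≠ s := fun h => hk (by simp [h])
    have hkt : k ∉ t := fun h => hk (by simp [h])
    have hs1 : s ∉ insert k t.toFinset := by simp [hst, hks.symm]
    have e : insert k (s :: t).toFinset = insert s (insert k t.toFinset) := by
      rw [List.toFinset_cons, Finset.insert_comm]
    have hM1 := hM.cons (by simpa using hk)
    have hN1 := hN.cons (by simpa using hk)
    have hN2 : IsSMulRegular (QuotSMulTop (f k) N) (f s) := by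
      have := hN1.2
      rw [List.toFinset_cons] at this
      exact (this.cons (by simpa using hst)).1
    rw [e] at hM hN
    have hM3 := hM.cons hs1
    have hN3 := hN.cons hs1
    have hreg : IsSMulRegular Q (f s) := by
      rw [isSMulRegular_iff_right_eq_zero_of_smul]
      intro q0 hq0
      obtain ⟨q, rfl⟩ := hψ q0
      rw [← map_smul] at hq0
      obtain ⟨y, hy⟩ := (hex _).1 hq0
      have h2 := hq (ψ q)
      rw [← map_smul] at h2
      obtain ⟨p, hp⟩ := (hex _).1 h2
      obtain ⟨p', rfl⟩ := pow_reg hN1.1 hN2 n p y (by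
        apply hφ
        rw [map_smul, map_smul, hp, hy, smul_comm])
      have : φ p' = q := by
        apply (hM1.1.pow n)
        show f k ^ n • φ p' = f k ^ n • q
        rw [← map_smul, hp]
      rw [← this]
      exact (hex _).2 ⟨p', rfl⟩
    rw [List.map_cons, RingTheory.Sequence.isWeaklyRegular_cons_iff]
    refine ⟨hreg, ih (QuotSMulTop.map (f s) φ) (QuotSMulTop.map (f s) ψ) ?_
      (QuotSMulTop.map_surjective _ hψ) (QuotSMulTop.map_exact _ hex hψ) ?_
      (List.nodup_cons.1 hl).2 hkt hM3.2 hN3.2⟩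
    · rw [injective_iff_map_eq_zero]
      intro a ha
      obtain ⟨a, rfl⟩ := Submodule.Quotient.mk_surjective _ a
      rw [QuotSMulTop.map_apply_mk, mem_smul_top'] at ha
      obtain ⟨m, hm⟩ := ha
      have : ψ m = 0 := by
        apply hreg
        show f s • ψ m = f s • 0
        rw [← map_smul, hm, smul_zero]
        exact (hex _).2 ⟨a, rfl⟩
      obtain ⟨n', rfl⟩ := (hex _).1 this
      rw [mem_smul_top']
      exact ⟨n', hφ (by rw [map_smul, hm])⟩
    · intro q
      obtain ⟨q, rfl⟩ := Submodule.Quotient.mk_surjective _ q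
      rw [← Submodule.Quotient.mk_smul, hq, Submodule.Quotient.mk_zero]

lemma regF_of_flat {S : Finset ι} (hf : IsFamilyASeq S f) (M : Type v) [AddCommGroup M]
    [Module A M] [Module.Flat A M] : RegF f S M := by
  intro l hl hS
  have h := (hf l hl hS).2
  have hA : RingTheory.Sequence.IsWeaklyRegular A (l.map f) := by
    rw [RingTheory.Sequence.isWeaklyRegular_iff_Fin]
    intro i
    rw [isSMulRegular_iff_right_eq_zero_of_smul]
    intro q hq
    obtain ⟨q, rfl⟩ := Submodule.Quotient.mk_surjective _ q
    rw [← Submodule.Quotient.mk_smul, Submodule.Quotient.mk_eq_zero] at hq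
    rw [Submodule.Quotient.mk_eq_zero]
    rw [smul_eq_mul, Ideal.mul_top] at *
    exact h i q hq
  exact ((TensorProduct.lid A M).isWeaklyRegular_congr _).1 (hA.isWeaklyRegular_rTensor)

end alg

/-- The inductive property. -/
def Good {A : Type u} [CommRing A] {ι : Type w} [DecidableEq ι]
    (x : Cube (ModuleCat.{u} A) ι) (S : Finset ι) (f : ι → A) : Prop :=
  (∀ T ⊆ S, RegF f S (x.vtx T)) ∧
  ∀ T ⊆ S, ∀ k ∈ T, ∀ U, ∀ h : U ⊆ T, U = T.erase k →
    Function.Injective (x.mapLE h).hom ∧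
    ∃ n : ℕ, ∀ m : x.vtx U, ∃ p, (x.mapLE h).hom p = f k ^ n • m

section cube

variable {A : Type u} [CommRing A] {ι : Type w} [DecidableEq ι] {f : ι → A}

/-- The projection to a vertex of `H0`. -/
noncomputable def H0π (x : Cube (ModuleCat.{u} A) ι) (k : ι) (T : Finset ι) :
    x.vtx ((insert k T).erase k) ⟶ (x.H0 k).vtx T :=
  cokernel.π (x.bd (insert k T) k)

lemma H0π_surj (x : Cube (ModuleCat.{u} A) ι) (k : ι) (T : Finset ι) :
    Function.Surjective (H0π x k T).hom :=
  (ModuleCat.epi_iff_surjective _).1 (inferInstanceAs (Epi (cokernel.π (x.bd (insert k T) k))))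

lemma H0π_exact (x : Cube (ModuleCat.{u} A) ι) (k : ι) (T : Finset ι) :
    Function.Exact (x.bd (insert k T) k).hom (H0π x k T).hom :=
  (ShortComplex.ShortExact.moduleCat_exact_iff_function_exact _).1
    (ShortComplex.exact_cokernel (x.bd (insert k T) k))

lemma H0π_nat (x : Cube (ModuleCat.{u} A) ι) (k : ι) {T U : Finset ι} (h : U ⊆ T)
    (m : x.vtx ((insert k T).erase k)) :
    ((x.H0 k).mapLE h).hom ((H0π x k T).hom m) =
      (H0π x k U).hom ((x.mapLE (Finset.erase_subset_erase k
        (Finset.insert_subset_insert k h))).hom m) := by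
  have : H0π x k T ≫ (x.H0 k).mapLE h =
      x.mapLE (Finset.erase_subset_erase k (Finset.insert_subset_insert k h)) ≫ H0π x k U :=
    cokernel.π_desc _ _ _
  exact congrArg (fun g => g.hom m) this

lemma mapLE_mapLE (x : Cube (ModuleCat.{u} A) ι) {T U V : Finset ι} (h1 : U ⊆ T) (h2 : V ⊆ U)
    (m : x.vtx T) :
    (x.mapLE h2).hom ((x.mapLE h1).hom m) = (x.mapLE (h2.trans h1)).hom m :=
  congrArg (fun g => g.hom m) (x.mapLE_comp h1 h2)

lemma Good.H0 {x : Cube (ModuleCat.{u} A) ι} {S : Finset ι} (hx : Good x S f) {k : ι}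
    (hk : k ∈ S) : Good (x.H0 k) (S.erase k) f := by
  have hkS : insert k (S.erase k) = S := Finset.insert_erase hk
  have hsub : ∀ T ⊆ S.erase k, insert k T ⊆ S := fun T hT =>
    Finset.insert_subset hk (hT.trans (Finset.erase_subset _ _))
  have hsub' : ∀ T ⊆ S.erase k, (insert k T).erase k ⊆ S := fun T hT =>
    (Finset.erase_subset _ _).trans (hsub T hT)
  have h1 : ∀ T ⊆ S.erase k, RegF f (S.erase k) ((x.H0 k).vtx T) := by
    intro T hT l hl hlS
    obtain ⟨hinj, n, hn⟩ := hx.2 (insert k T) (hsub T hT) k (Finset.mem_insert_self _ _) _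
      (Finset.erase_subset k _) rfl
    have hkl : k ∉ l := by
      intro h
      have : k ∈ l.toFinset := by simpa using h
      rw [hlS] at this
      simp at this
    refine main_list k n l (x.bd (insert k T) k).hom (H0π x k T).hom hinj (H0π_surj x k T)
      (H0π_exact x k T) ?_ hl hkl ?_ ?_
    · intro q
      obtain ⟨m, rfl⟩ := H0π_surj x k T q
      obtain ⟨p, hp⟩ := hn m
      rw [← map_smul]
      exact (H0π_exact x k T _).2 ⟨p, hp⟩
    · rw [hlS, hkS]; exact hx.1 _ (hsub' T hT)
    · rw [hlS, hkS]; exact hx.1 _ (hsub T hT)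
  refine ⟨h1, ?_⟩
  intro T hT j hj U h hU
  have hjS := hT hj
  have hjk : j ≠ k := (Finset.mem_erase.1 hjS).1
  have e1 : insert k U = (insert k T).erase j := by
    rw [hU, Finset.erase_insert_of_ne hjk.symm]
  have e2 : (insert k U).erase k = ((insert k T).erase k).erase j := by
    rw [e1, Finset.erase_right_comm]
  obtain ⟨-, n, hn⟩ := hx.2 (insert k T) (hsub T hT) j (Finset.mem_insert_of_mem hj) (insert k U)
    (Finset.insert_subset_insert k h) e1
  obtain ⟨hinj, n', hn'⟩ := hx.2 ((insert k T).erase k) (hsub' T hT) j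
    (Finset.mem_erase.2 ⟨hjk, Finset.mem_insert_of_mem hj⟩) ((insert k U).erase k)
    (Finset.erase_subset_erase k (Finset.insert_subset_insert k h)) e2
  have hreg : IsSMulRegular ((x.H0 k).vtx T) (f j) := by
    have := h1 T hT
    rw [← Finset.insert_erase hjS] at this
    exact (this.cons (Finset.notMem_erase _ _)).1
  refine ⟨?_, n', ?_⟩
  · rw [injective_iff_map_eq_zero]
    intro q hq
    obtain ⟨m, rfl⟩ := H0π_surj x k T q
    rw [H0π_nat] at hq
    obtain ⟨p, hp⟩ := (H0π_exact x k U _).1 hq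
    obtain ⟨p', hp'⟩ := hn p
    apply hreg.pow n
    show f j ^ n • (H0π x k T).hom m = f j ^ n • 0
    rw [smul_zero, ← map_smul]
    refine (H0π_exact x k T _).2 ⟨p', hinj ?_⟩
    rw [map_smul, ← hp, ← map_smul, ← hp']
    simp only [Cube.bd, mapLE_mapLE]
  · intro q
    obtain ⟨m, rfl⟩ := H0π_surj x k U q
    obtain ⟨p, hp⟩ := hn' m
    exact ⟨(H0π x k T).hom p, by rw [H0π_nat, hp, map_smul]⟩

lemma Good.admissible (c : ℕ) : ∀ (x : Cube (ModuleCat.{u} A) ι) (S : Finset ι),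
    S.card = c → Good x S f → x.Admissible S := by
  induction c with
  | zero =>
    intro x S hS hx
    rw [Finset.card_eq_zero] at hS
    subst hS
    rw [Cube.Admissible]
    refine ⟨fun T hT k hk => absurd (hT hk) (by simp), fun k hk => absurd hk (by simp)⟩
  | succ c ih =>
    intro x S hS hx
    rw [Cube.Admissible]
    refine ⟨fun T hT k hk => (ModuleCat.mono_iff_injective _).2
      (hx.2 T hT k hk _ (Finset.erase_subset k T) rfl).1, fun k hk => ih _ _ ?_ (hx.H0 hk)⟩
    rw [Finset.card_erase_of_mem hk, hS]; rfl

end cube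

/-- Every Koszul cube over a commutative noetherian ring `A` (an `S`-cube
of finitely generated projective `A`-modules associated with an `A`-sequence
`{f s}_{s ∈ S}`) is admissible. -/
theorem koszul_cube_admissible {A : Type u} [CommRing A] [IsNoetherianRing A]
    {ι : Type w} [DecidableEq ι] (S : Finset ι) (f : ι → A) (hf : IsFamilyASeq S f)
    (x : Cube (ModuleCat.{u} A) ι) (hx : IsKoszulCube x S f) :
    x.Admissible S := by
  refine Good.admissible (f := f) S.card x S rfl ⟨fun T hT => ?_, fun T hT k hk U h hU => ?_⟩
  · have := (hx.1 T hT).2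
    exact regF_of_flat hf _
  · subst hU
    obtain ⟨hi, -, n, hn⟩ := hx.2 T hT k hk
    refine ⟨hi, n, fun m => ?_⟩
    have := hn (Submodule.Quotient.mk m)
    rw [← Submodule.Quotient.mk_smul, Submodule.Quotient.mk_eq_zero] at this
    exact this
end
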